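/- arXiv:2508.03150 — 3 statements merged into one kernel-verified Lean document; each statement's English description precedes it below -/
import Mathlib

section
/- Truncated Schur multiple zeta values as ninth variations (Lemma 5.1): Let M, N be positive integers, r, m integers, and a : ℤ → ℂ. Define N×N complex matrices U_k := (E + k^{−a(1−r)}E_{1,2})(E + k^{−a(2−r)}E_{2,3})⋯(E + k^{−a(N−1−r)}E_{N−1,N}) for 1 ≤ k ≤ M (where k^{−s} := exp(−s·log k) for a positive integer k and s ∈ ℂ), and U := U_1 U_2 ⋯ U_M. Let λ ⊇ μ be partitions with ℓ(λ) ≤ r+m ≤ N and λ_1 ≤ N−(r+m). Then ζ^M_{λ/μ}(τ^m a) = S^{(r+m)}_{λ/μ}(U). -/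
open Matrix BigOperators Finset Filter

/-- Extend a `Fin N`-indexed matrix to `ℕ` indices by zero. -/
def matExt {R : Type*} [Zero R] {N : ℕ} (U : Matrix (Fin N) (Fin N) R) : ℕ → ℕ → R :=
  fun i j => if hi : i < N then (if hj : j < N then U ⟨i, hi⟩ ⟨j, hj⟩ else 0) else 0

/-- `U` is upper unitriangular. -/
def UpperUni {R : Type*} [Zero R] [One R] {N : ℕ} (U : Matrix (Fin N) (Fin N) R) : Prop :=
  (∀ i, U i i = 1) ∧ ∀ i j : Fin N, (j : ℕ) < (i : ℕ) → U i j = 0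

/-- `L` is lower unitriangular. -/
def LowerUni {R : Type*} [Zero R] [One R] {N : ℕ} (L : Matrix (Fin N) (Fin N) R) : Prop :=
  (∀ i, L i i = 1) ∧ ∀ i j : Fin N, (i : ℕ) < (j : ℕ) → L i j = 0

/-- 0-based entries of the Maya diagram `J(λ;r)` (the `a`-th smallest element, minus 1):
for `a = 0,…,r-1` this is `λ_{r-a} + a` (with `λ` 0-based). -/
def maya (lam : ℕ → ℕ) (r : ℕ) (a : Fin r) : ℕ := lam (r - 1 - (a : ℕ)) + (a : ℕ)

/-- The ninth variation of the skew Schur function `S^{(r)}_{λ/μ}(U)`: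
the minor of `U` on rows `J(μ;r)` and columns `J(λ;r)`. -/
def SchurV {R : Type*} [CommRing R] {N : ℕ} (U : Matrix (Fin N) (Fin N) R)
    (r : ℕ) (lam mu : ℕ → ℕ) : R :=
  Matrix.det (Matrix.of fun i j : Fin r => matExt U (maya mu r i) (maya lam r j))

/-- Conjugate partition (0-based), counting parts among indices `< B`. -/
def conjF (f : ℕ → ℕ) (B : ℕ) : ℕ → ℕ :=
  fun i => ((Finset.range B).filter fun j => i + 1 ≤ f j).card

/-- The hook partition `(a+1, 1^b)` (0-based function). -/
def hookP (a b : ℕ) : ℕ → ℕ := fun k => if k = 0 then a + 1 else if k ≤ b then 1 else 0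

/-- `h^{(r)}_d(U) = S^{(r)}_{(d)}(U)`, zero for `d < 0`. -/
def hSV {R : Type*} [CommRing R] {N : ℕ} (U : Matrix (Fin N) (Fin N) R) (r : ℕ) (d : ℤ) : R :=
  if 0 ≤ d then SchurV U r (fun k => if k = 0 then d.toNat else 0) (fun _ => 0) else 0

/-- `e^{(r)}_d(U) = S^{(r)}_{(1^d)}(U)`, zero for `d < 0`. -/
def eSV {R : Type*} [CommRing R] {N : ℕ} (U : Matrix (Fin N) (Fin N) R) (r : ℕ) (d : ℤ) : R :=
  if 0 ≤ d then SchurV U r (fun k => if k < d.toNat then 1 else 0) (fun _ => 0) else 0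

/-- The partition with Frobenius coordinates `(a|b)` (all 0-based as functions). -/
def frobP (p : ℕ) (a b : Fin p → ℕ) : ℕ → ℕ :=
  fun i => if h : i < p then a ⟨i, h⟩ + i + 1
    else (Finset.univ.filter fun j : Fin p => i < b j + (j : ℕ) + 1).card

/-- `f : ℕ → ℤ` is a partition of length `≤ B`. -/
def IsPartZ (B : ℕ) (f : ℕ → ℤ) : Prop :=
  (∀ i, f (i + 1) ≤ f i) ∧ (∀ i, 0 ≤ f i) ∧ (∀ i, B ≤ i → f i = 0)

/-- `lam/mu` is a skew partition (of length `≤ B`). -/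
def IsSkewZ (B : ℕ) (lam mu : ℕ → ℤ) : Prop :=
  IsPartZ B lam ∧ IsPartZ B mu ∧ ∀ i, mu i ≤ lam i

open Classical in
/-- `S^{(r)}_{λ/μ}(U)` with the convention that it is `0` if `λ/μ` is not a skew partition. -/
noncomputable def SchurVz {R : Type*} [CommRing R] {N : ℕ} (U : Matrix (Fin N) (Fin N) R)
    (r B : ℕ) (lam mu : ℕ → ℤ) : R :=
  if IsSkewZ B lam mu then SchurV U r (fun i => (lam i).toNat) (fun i => (mu i).toNat) else 0

open Classical in
/-- `S^{(r)}_{λ'/μ'}(U)` applied to the conjugates, with the zero convention. -/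
noncomputable def SchurVzConj {R : Type*} [CommRing R] {N : ℕ} (U : Matrix (Fin N) (Fin N) R)
    (r B : ℕ) (lam mu : ℕ → ℤ) : R :=
  if IsSkewZ B lam mu then
    SchurV U r (conjF (fun i => (lam i).toNat) B) (conjF (fun i => (mu i).toNat) B) else 0

/-- `lam/mu` is a skew partition (ℕ-valued version). -/
def IsSkewN (B : ℕ) (lam mu : ℕ → ℕ) : Prop :=
  (∀ i, lam (i + 1) ≤ lam i) ∧ (∀ i, mu (i + 1) ≤ mu i) ∧ (∀ i, mu i ≤ lam i) ∧
    (∀ i, B ≤ i → lam i = 0)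

open Classical in
noncomputable def SchurVn {R : Type*} [CommRing R] {N : ℕ} (U : Matrix (Fin N) (Fin N) R)
    (r B : ℕ) (lam mu : ℕ → ℕ) : R :=
  if IsSkewN B lam mu then SchurV U r lam mu else 0

/-- The rectangular partition `[m|n] = (n^m)`. -/
def rectP (m n : ℕ) : ℕ → ℕ := fun i => if i < m then n else 0

/-- `[m|n]^l = ((n+1)^l, n^{m-l})`. -/
def rectUpP (m n l : ℕ) : ℕ → ℕ := fun i => if i < l then n + 1 else if i < m then n else 0

/-- `[m|n]_k = (n^m, k)`. -/
def rectLowP (m n k : ℕ) : ℕ → ℕ := fun i => if i < m then n else if i = m then k else 0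

/-- `E + c·E_{t,t+1}` (indices 0-based). -/
def elemMat {R : Type*} [CommRing R] (N t : ℕ) (c : R) : Matrix (Fin N) (Fin N) R :=
  1 + Matrix.of (fun i j : Fin N => if (i : ℕ) = t ∧ (j : ℕ) = t + 1 then c else 0)

/-- `U = U_1 ⋯ U_M` with `U_k = (E + w_{k,1-r}E_{1,2}) ⋯ (E + w_{k,N-1-r}E_{N-1,N})`. -/
def UmatW {R : Type*} [CommRing R] (N M : ℕ) (r : ℤ) (w : ℕ → ℤ → R) :
    Matrix (Fin N) (Fin N) R :=
  ((List.range M).map fun k =>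
    ((List.range (N - 1)).map fun t => elemMat N t (w (k + 1) ((t : ℤ) + 1 - r))).prod).prod

/-- The partition `(m_1^{r_1} m_2^{r_2-r_1} ⋯ m_n^{r_n-r_{n-1}})` (corner data 0-based). -/
def stepPart (n : ℕ) (m rr : ℕ → ℕ) : ℕ → ℕ :=
  fun i =>
    if h : (((Finset.range n).filter fun j => i < rr j)).Nonempty then
      m (((Finset.range n).filter fun j => i < rr j).min' h)
    else 0

/-- `Add_{a,b}` (rows 1-based in `a`, `b`; the function argument is 0-based). -/
def AddOp (a b : ℕ) (k : ℕ → ℕ) : ℕ → ℕ := fun i =>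
  if i + 1 ≤ a then k i
  else if i + 1 = a + 1 then k (a - 1)
  else if i + 1 ≤ b + 1 then k (i - 1) + 1
  else k i

/-- `Rem_{a,b}`. -/
def RemOp (a b : ℕ) (k : ℕ → ℕ) : ℕ → ℕ := fun i =>
  if i + 1 < a then k i
  else if i + 1 ≤ b - 1 then k (i + 1) - 1
  else if i + 1 = b then k b
  else k i

/-- `op_{a 0, b 0} ∘ op_{a 1, b 1} ∘ ⋯ ∘ op_{a (t-1), b (t-1)}` applied to `k`. -/
def iterOp (op : ℕ → ℕ → (ℕ → ℕ) → ℕ → ℕ) (t : ℕ) (a b : ℕ → ℕ) (k : ℕ → ℕ) : ℕ → ℕ :=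
  (List.range t).foldr (fun i acc => op (a i) (b i) acc) k

/-- the `i`-th smallest element of a finite set of naturals (0-based). -/
def ascNth (s : Finset ℕ) (i : ℕ) : ℕ := (s.sort (· ≤ ·)).getD i 0

/-- The cells of the skew Young diagram `D(λ/μ)` (0-based, rows `< B`). -/
def cellsD (B : ℕ) (lam mu : ℕ → ℕ) : Finset (ℕ × ℕ) :=
  (Finset.range B ×ˢ Finset.range (lam 0 + 1)).filter fun p => mu p.1 ≤ p.2 ∧ p.2 < lam p.1

/-- Semistandardness: weakly increasing along rows, strictly increasing down columns. -/
def IsSSYT {M B : ℕ} {lam mu : ℕ → ℕ} (T : ↥(cellsD B lam mu) → Fin M) : Prop :=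
  (∀ c c' : ↥(cellsD B lam mu), c.val.1 = c'.val.1 → c.val.2 ≤ c'.val.2 → T c ≤ T c') ∧
  (∀ c c' : ↥(cellsD B lam mu), c.val.1 < c'.val.1 → c.val.2 = c'.val.2 → T c < T c')

open Classical in
/-- Sum over all semistandard tableaux of shape `λ/μ` with entries in `{1,…,M}` of
the product over cells `c` of `f (entry) c`. -/
noncomputable def tabSum {R : Type*} [CommRing R] (M B : ℕ) (lam mu : ℕ → ℕ)
    (f : ℕ → ℕ × ℕ → R) : R :=
  ∑ T ∈ Finset.univ.filter (fun T : ↥(cellsD B lam mu) → Fin M => IsSSYT T),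
    ∏ c : ↥(cellsD B lam mu), f ((T c : ℕ) + 1) c.val

/-- `M`-truncated Schur multiple zeta value for a general filling `s` of the diagram. -/
noncomputable def zetaTF (M B : ℕ) (lam mu : ℕ → ℕ) (s : ℕ × ℕ → ℂ) : ℂ :=
  tabSum M B lam mu fun k c => (k : ℂ) ^ (-(s c))

/-- `M`-truncated diagonally constant Schur multiple zeta value `ζ^M_{λ/μ}(a)`. -/
noncomputable def zetaT (M B : ℕ) (lam mu : ℕ → ℕ) (a : ℤ → ℂ) : ℂ :=
  zetaTF M B lam mu fun c => a ((c.2 : ℤ) - (c.1 : ℤ))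

open Classical in
/-- `ζ^M_{λ/μ}(a)` with the zero convention for non-skew shapes. -/
noncomputable def zetaZ (M B : ℕ) (lam mu : ℕ → ℤ) (a : ℤ → ℂ) : ℂ :=
  if IsSkewZ B lam mu then
    zetaT M B (fun i => (lam i).toNat) (fun i => (mu i).toNat) a else 0

open Classical in
/-- `ζ^M_{λ'/μ'}(a)` applied to conjugates, with the zero convention. -/
noncomputable def zetaZConj (M B : ℕ) (lam mu : ℕ → ℤ) (a : ℤ → ℂ) : ℂ :=
  if IsSkewZ B lam mu then
    zetaT M (lam 0).toNat (conjF (fun i => (lam i).toNat) B)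
      (conjF (fun i => (mu i).toNat) B) a
  else 0

open Classical in
/-- `M`-truncated multiple zeta-star value `ζ^{⋆,M}(s_0,…,s_{d-1})`. -/
noncomputable def zetaStarT (M d : ℕ) (s : ℕ → ℂ) : ℂ :=
  ∑ f ∈ Finset.univ.filter (fun f : Fin d → Fin M => ∀ i j : Fin d, i ≤ j → f i ≤ f j),
    ∏ i : Fin d, (((f i : ℕ) + 1 : ℕ) : ℂ) ^ (-(s i))

open Classical in
/-- `M`-truncated multiple zeta value `ζ^{M}(s_0,…,s_{d-1})`. -/
noncomputable def zetaMT (M d : ℕ) (s : ℕ → ℂ) : ℂ :=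
  ∑ f ∈ Finset.univ.filter (fun f : Fin d → Fin M => ∀ i j : Fin d, i < j → f i < f j),
    ∏ i : Fin d, (((f i : ℕ) + 1 : ℕ) : ℂ) ^ (-(s i))

/-- The Riemann zeta value `ζ(k) = Σ_{n ≥ 1} n^{-k}`. -/
noncomputable def zetaVal (k : ℕ) : ℂ := ∑' n : ℕ, ((n + 1 : ℕ) : ℂ) ^ (-(k : ℤ))

/-- `ζ^⋆(1,k) = Σ_{1 ≤ m ≤ n} m^{-1} n^{-k}`. -/
noncomputable def zetaStarOne (k : ℕ) : ℂ :=
  ∑' n : ℕ, (∑ m ∈ Finset.Icc 1 (n + 1), ((m : ℂ))⁻¹) * ((n + 1 : ℕ) : ℂ) ^ (-(k : ℤ))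

section Helpers

theorem matExt_elem_mul {R : Type*} [CommRing R] {N : ℕ} (t : ℕ) (c : R)
    (V : Matrix (Fin N) (Fin N) R) (i j : ℕ) :
    matExt (elemMat N t c * V) i j =
      matExt V i j + (if i = t then c * matExt V (t + 1) j else 0) := by
  unfold matExt
  by_cases hj : j < N
  · by_cases hi : i < N
    · simp only [hi, hj, dif_pos]
      rw [elemMat, Matrix.add_mul, Matrix.one_mul, Matrix.add_apply]
      congr 1
      rw [Matrix.mul_apply]
      simp only [Matrix.of_apply]
      by_cases hit : i = t
      · by_cases ht : t + 1 < N
        · rw [Finset.sum_eq_single (⟨t + 1, ht⟩ : Fin N)]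
          · simp [hit, ht]
          · intro b _ hb
            have : ¬ ((b : ℕ) = t + 1) := fun h => hb (Fin.ext h)
            simp [this]
          · simp
        · rw [Finset.sum_eq_zero]
          · simp [ht]
          · intro b _
            have : ¬ ((b : ℕ) = t + 1) := by have := b.2; omega
            simp [this]
      · simp [hit]
    · have : i = t → ¬ (t + 1 < N) := by omega
      by_cases hit : i = t
      · have h2 := this hit
        simp [hi, h2]
      · simp [hi, hit]
  · simp [hj]

theorem maya_strictMono (mu : ℕ → ℕ) (hmu : Antitone mu) (r : ℕ) :
    StrictMono (maya mu r) := by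
  intro a b hab
  unfold maya
  have : mu (r - 1 - (a : ℕ)) ≤ mu (r - 1 - (b : ℕ)) := hmu (by omega)
  have : (a : ℕ) < b := hab
  omega

/-- row `i` of the partition can be enlarged -/
def Addable (mu : ℕ → ℕ) (i : ℕ) : Prop := i = 0 ∨ mu i < mu (i - 1)

theorem schurV_step_row {R : Type*} [CommRing R] {N : ℕ} (t : ℕ) (c : R)
    (V : Matrix (Fin N) (Fin N) R) (r : ℕ) (lam mu : ℕ → ℕ) (hmu : Antitone mu)
    (i : ℕ) (hi : i < r) (ht : mu i + (r - 1 - i) = t) :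
    SchurV (elemMat N t c * V) r lam mu =
      SchurV V r lam mu + c * SchurV V r lam (Function.update mu i (mu i + 1)) := by
  have hinj := (maya_strictMono mu hmu r).injective
  set i' : Fin r := ⟨r - 1 - i, by omega⟩ with hi'
  have hsub : r - 1 - (r - 1 - i) = i := by omega
  have hpi : maya mu r i' = t := by simp [maya, hi', hsub, ht]
  unfold SchurV
  have key : (Matrix.of fun x y : Fin r => matExt (elemMat N t c * V) (maya mu r x) (maya lam r y))
      = Matrix.updateRow (Matrix.of fun x y : Fin r => matExt V (maya mu r x) (maya lam r y)) i'
        ((fun y => matExt V (maya mu r i') (maya lam r y)) +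
          c • (fun y => matExt V (t + 1) (maya lam r y))) := by
    ext x y
    by_cases hx : x = i'
    · subst hx
      simp [matExt_elem_mul, hpi]
    · have : maya mu r x ≠ t := fun h => hx (hinj (h.trans hpi.symm))
      simp [matExt_elem_mul, this, Matrix.updateRow_ne hx]
  rw [key, Matrix.det_updateRow_add, Matrix.det_updateRow_smul]
  congr 1
  · congr 1
    ext x y
    by_cases hx : x = i'
    · subst hx; simp
    · simp [Matrix.updateRow_ne hx]
  · congr 2
    ext x y
    by_cases hx : x = i'
    · subst hx
      have : maya (Function.update mu i (mu i + 1)) r i' = t + 1 := by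
        simp [maya, hi', hsub]; omega
      simp [this]
    · have : maya (Function.update mu i (mu i + 1)) r x = maya mu r x := by
        have hne : r - 1 - (x : ℕ) ≠ i := by
          intro h; apply hx; ext; simp [hi']; omega
        simp [maya, Function.update_of_ne hne]
      simp [Matrix.updateRow_ne hx, this]

theorem schurV_blocked {R : Type*} [CommRing R] {N : ℕ}
    (V : Matrix (Fin N) (Fin N) R) (r : ℕ) (lam mu : ℕ → ℕ) (hmu : Antitone mu)
    (i : ℕ) (hi : i < r) (h : ¬ Addable mu i) :
    SchurV V r lam (Function.update mu i (mu i + 1)) = 0 := by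
  unfold Addable at h
  push Not at h
  obtain ⟨h0, h1⟩ := h
  have h2 : mu i = mu (i - 1) := le_antisymm (hmu (by omega)) h1
  unfold SchurV
  have hne : (⟨r - 1 - i, by omega⟩ : Fin r) ≠ ⟨r - 1 - (i - 1), by omega⟩ := by
    intro h; have := congrArg Fin.val h; simp at this; omega
  apply Matrix.det_zero_of_row_eq hne
  ext y
  have e1 : r - 1 - (r - 1 - i) = i := by omega
  have e2 : r - 1 - (r - 1 - (i - 1)) = i - 1 := by omega
  have e3 : i - 1 ≠ i := by omega
  simp only [Matrix.of_apply, maya, e1, e2, Function.update_self, Function.update_of_ne e3]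
  congr 1
  omega

theorem schurV_step_none {R : Type*} [CommRing R] {N : ℕ} (t : ℕ) (c : R)
    (V : Matrix (Fin N) (Fin N) R) (r : ℕ) (lam mu : ℕ → ℕ) (hmu : Antitone mu)
    (hno : ¬ ∃ i, i < r ∧ mu i + (r - 1 - i) = t ∧ Addable mu i) :
    SchurV (elemMat N t c * V) r lam mu = SchurV V r lam mu := by
  by_cases h : ∃ i, i < r ∧ mu i + (r - 1 - i) = t
  · obtain ⟨i, hi, ht⟩ := h
    rw [schurV_step_row t c V r lam mu hmu i hi ht,
      schurV_blocked V r lam mu hmu i hi (fun ha => hno ⟨i, hi, ht, ha⟩)]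
    simp
  · unfold SchurV
    congr 1
    ext x y
    have : maya mu r x ≠ t := by
      intro hx
      apply h
      refine ⟨r - 1 - x, by omega, ?_⟩
      have : r - 1 - (r - 1 - (x : ℕ)) = x := by omega
      rw [this]; exact hx
    simp [matExt_elem_mul, this]

open Classical in
theorem schurV_one {R : Type*} [CommRing R] {N : ℕ} (r : ℕ) (lam mu : ℕ → ℕ)
    (hlam : Antitone lam) (hmu : Antitone mu)
    (hl0 : ∀ i, r ≤ i → lam i = 0) (hm0 : ∀ i, r ≤ i → mu i = 0)
    (hb : ∀ a, maya lam r a < N) :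
    SchurV (1 : Matrix (Fin N) (Fin N) R) r lam mu = if mu = lam then 1 else 0 := by
  have hent : ∀ i j : Fin r, matExt (1 : Matrix (Fin N) (Fin N) R) (maya mu r i) (maya lam r j)
      = if maya mu r i = maya lam r j then 1 else 0 := by
    intro i j
    unfold matExt
    have hj := hb j
    by_cases hi : maya mu r i < N
    · simp [hi, hj, Matrix.one_apply]
    · have : maya mu r i ≠ maya lam r j := by omega
      simp [hi, this]
  unfold SchurV
  simp only [hent]
  split_ifs with h
  · subst h
    have hinj := (maya_strictMono mu hmu r).injective
    have : (Matrix.of fun i j : Fin r => if maya mu r i = maya mu r j then (1 : R) else 0) = 1 := by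
      ext i j
      simp [Matrix.one_apply, hinj.eq_iff]
    rw [this, Matrix.det_one]
  · rw [Matrix.det_apply]
    apply Finset.sum_eq_zero
    intro σ _
    by_cases hs : ∀ i, maya mu r (σ i) = maya lam r i
    · exfalso
      apply h
      have hr : Set.range (maya mu r) = Set.range (maya lam r) := by
        have : maya lam r = maya mu r ∘ σ := funext fun i => (hs i).symm
        rw [this, Set.range_comp, σ.surjective.range_eq, Set.image_univ]
      have he : maya mu r = maya lam r :=
        ((maya_strictMono mu hmu r).range_inj (maya_strictMono lam hlam r)).1 hr
      ext i
      by_cases hi : i < r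
      · have := congrFun he ⟨r - 1 - i, by omega⟩
        have e1 : r - 1 - (r - 1 - i) = i := by omega
        simp only [maya, e1] at this
        omega
      · rw [hl0 i (by omega), hm0 i (by omega)]
    · push Not at hs
      obtain ⟨i, hi⟩ := hs
      rw [Finset.prod_eq_zero (Finset.mem_univ i)]
      · simp
      · simp [hi]

theorem antitone_update (mu : ℕ → ℕ) (hmu : Antitone mu) (i : ℕ) (h : Addable mu i) :
    Antitone (Function.update mu i (mu i + 1)) := by
  apply antitone_nat_of_succ_le
  intro n
  have := hmu (Nat.le_succ n)
  simp only [Function.update_apply]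
  rcases h with h | h
  · subst h
    split_ifs <;> first | omega | (subst_vars; simp_all <;> omega)
  · split_ifs with h1 h2 h2
    · omega
    · have : i - 1 = n := by omega
      rw [this] at h; omega
    · subst h2; exact this.trans (by omega)
    · exact this

/-- product of the elementary matrices of steps `s, …, s+n-1`. -/
def tailProd {R : Type*} [CommRing R] (N : ℕ) (K : ℕ) (W : ℕ → R) (s n : ℕ) :
    Matrix (Fin N) (Fin N) R :=
  ((List.range' s n).map fun x => elemMat N (x % K) (W x)).prod

theorem tailProd_succ {R : Type*} [CommRing R] (N : ℕ) (K : ℕ) (W : ℕ → R) (s n : ℕ) :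
    tailProd N K W s (n + 1) = elemMat N (s % K) (W s) * tailProd N K W (s + 1) n := by
  simp [tailProd, List.range'_succ]

theorem schurV_not_le {R : Type*} [CommRing R] (N K : ℕ) (W : ℕ → R) (r : ℕ) (lam : ℕ → ℕ)
    (hlam : Antitone lam) (hl0 : ∀ i, r ≤ i → lam i = 0) (hb : ∀ a, maya lam r a < N) (n : ℕ) :
    ∀ (s : ℕ) (mu : ℕ → ℕ), Antitone mu → (∀ i, r ≤ i → mu i = 0) →
      (∃ i, lam i < mu i) → SchurV (tailProd N K W s n) r lam mu = 0 := by
  induction n with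
  | zero =>
    intro s mu hmu hm0 ⟨i, hi⟩
    have : tailProd N K W s 0 = 1 := by simp [tailProd]
    rw [this, schurV_one r lam mu hlam hmu hl0 hm0 hb, if_neg]
    rintro rfl
    omega
  | succ n ih =>
    intro s mu hmu hm0 hex
    rw [tailProd_succ]
    by_cases h : ∃ i, i < r ∧ mu i + (r - 1 - i) = s % K ∧ Addable mu i
    · obtain ⟨i, hi, ht, ha⟩ := h
      rw [schurV_step_row _ _ _ r lam mu hmu i hi ht, ih _ mu hmu hm0 hex,
        ih _ _ (antitone_update mu hmu i ha)]
      · simp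
      · intro j hj
        rw [Function.update_of_ne (by omega)]; exact hm0 j hj
      · obtain ⟨j, hj⟩ := hex
        refine ⟨j, ?_⟩
        rw [Function.update_apply]; split_ifs with h
        · subst h; omega
        · exact hj
    · rw [schurV_step_none _ _ _ r lam mu hmu h, ih _ mu hmu hm0 hex]

/-- diagonal of a cell -/
def dg (r : ℕ) (c : ℕ × ℕ) : ℕ := c.2 + (r - 1 - c.1)

/-- fillings whose cells outside `mu` are semistandard and all come at time `≥ s`. -/
def PP (M K r : ℕ) (X : Finset (ℕ × ℕ)) (mu : ℕ → ℕ) (s : ℕ) (g : X → Fin M) : Prop :=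
  (∀ c : X, c.1.2 < mu c.1.1 → (g c : ℕ) = 0) ∧
  (∀ c c' : X, mu c.1.1 ≤ c.1.2 → c.1.1 = c'.1.1 → c.1.2 ≤ c'.1.2 → g c ≤ g c') ∧
  (∀ c c' : X, mu c.1.1 ≤ c.1.2 → mu c'.1.1 ≤ c'.1.2 → c.1.1 < c'.1.1 → c.1.2 = c'.1.2 →
    g c < g c') ∧
  (∀ c : X, mu c.1.1 ≤ c.1.2 → s ≤ (g c : ℕ) * K + dg r c.1)

/-- weight of a filling -/
def wt {R : Type*} [CommRing R] (M K r : ℕ) (X : Finset (ℕ × ℕ)) (W : ℕ → R) (mu : ℕ → ℕ)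
    (g : X → Fin M) : R :=
  ∏ c : X, if mu c.1.1 ≤ c.1.2 then W ((g c : ℕ) * K + dg r c.1) else 1

open Classical in
/-- the partial tableau sum -/
noncomputable def FF {R : Type*} [CommRing R] (M K r : ℕ) (X : Finset (ℕ × ℕ)) (W : ℕ → R)
    (mu : ℕ → ℕ) (s : ℕ) : R :=
  ∑ g ∈ Finset.univ.filter (fun g : X → Fin M => PP M K r X mu s g), wt M K r X W mu g

theorem mem_cellsD' (B : ℕ) (lam mu : ℕ → ℕ) (hlam : Antitone lam) (c : ℕ × ℕ) :
    c ∈ cellsD B lam mu ↔ c.1 < B ∧ mu c.1 ≤ c.2 ∧ c.2 < lam c.1 := by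
  have := hlam (Nat.zero_le c.1)
  simp only [cellsD, Finset.mem_filter, Finset.mem_product, Finset.mem_range]
  omega

theorem corner_of_min {M K r : ℕ} {lam mu0 mu : ℕ → ℕ} (hlam : Antitone lam)
    (h0 : ∀ i, mu0 i ≤ mu i) (hK : ∀ c ∈ cellsD r lam mu0, dg r c < K)
    {s : ℕ} {g : cellsD r lam mu0 → Fin M}
    (hP : PP M K r (cellsD r lam mu0) mu s g) (c : cellsD r lam mu0)
    (hc : mu c.1.1 ≤ c.1.2) (hs : (g c : ℕ) * K + dg r c.1 = s) :
    mu c.1.1 = c.1.2 ∧ Addable mu c.1.1 ∧ (g c : ℕ) = s / K ∧ dg r c.1 = s % K := by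
  obtain ⟨⟨i, j⟩, hcX⟩ := c
  have hm := (mem_cellsD' r lam mu0 hlam _).1 hcX
  obtain ⟨p1, p2, p3, p4⟩ := hP
  have hd := hK _ hcX
  simp only at hc hm ⊢
  refine ⟨?_, ?_, ?_, ?_⟩
  · by_contra hne
    have hX' : (i, j - 1) ∈ cellsD r lam mu0 := by
      rw [mem_cellsD' _ _ _ hlam]
      have := h0 i
      simp only; omega
    have a1 := p2 ⟨(i, j - 1), hX'⟩ ⟨(i, j), hcX⟩ (by simp only; omega) rfl (by simp only; omega)
    have a2 := p4 ⟨(i, j - 1), hX'⟩ (by simp only; omega)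
    have a3 := Nat.mul_le_mul_right K (Fin.le_def.1 a1)
    simp only [dg] at a2 hs
    omega
  · by_contra hne
    unfold Addable at hne
    push Not at hne
    have hl := hlam (show i - 1 ≤ i by omega)
    have hX' : (i - 1, j) ∈ cellsD r lam mu0 := by
      rw [mem_cellsD' _ _ _ hlam]
      have := h0 (i - 1)
      simp only; omega
    have a1 := p3 ⟨(i - 1, j), hX'⟩ ⟨(i, j), hcX⟩ (by simp only; omega) hc
      (by simp only; omega) rfl
    have a2 := p4 ⟨(i - 1, j), hX'⟩ (by simp only; omega)
    have a3 := Nat.mul_le_mul_right K (Nat.succ_le_of_lt (Fin.lt_def.1 a1))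
    have hd' := hK _ hX'
    rw [Nat.succ_mul] at a3
    simp only at a2 a3 hs
    omega
  · rw [← hs, mul_comm, Nat.mul_add_div (by omega), Nat.div_eq_of_lt hd]; rfl
  · rw [← hs, mul_comm, Nat.mul_add_mod, Nat.mod_eq_of_lt hd]

theorem PP_mono {M K r : ℕ} {X : Finset (ℕ × ℕ)} {mu : ℕ → ℕ} {s : ℕ} {g : X → Fin M}
    (h : PP M K r X mu (s + 1) g) : PP M K r X mu s g :=
  ⟨h.1, h.2.1, h.2.2.1, fun c hc => (Nat.le_succ s).trans (h.2.2.2 c hc)⟩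

theorem FF_none {R : Type*} [CommRing R] {M K r : ℕ} {lam mu0 mu : ℕ → ℕ} (W : ℕ → R)
    (hlam : Antitone lam)
    (h0 : ∀ i, mu0 i ≤ mu i) (hK : ∀ c ∈ cellsD r lam mu0, dg r c < K) (s : ℕ)
    (hno : ¬ ∃ i, i < r ∧ mu i + (r - 1 - i) = s % K ∧ Addable mu i ∧ mu i < lam i) :
    FF M K r (cellsD r lam mu0) W mu s = FF M K r (cellsD r lam mu0) W mu (s + 1) := by
  unfold FF
  congr 1
  ext g
  simp only [Finset.mem_filter, Finset.mem_univ, true_and]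
  refine ⟨fun h => ⟨h.1, h.2.1, h.2.2.1, fun c hc => ?_⟩, PP_mono⟩
  have h1 := h.2.2.2 c hc
  by_contra h2
  obtain ⟨a1, a2, a3, a4⟩ := corner_of_min hlam h0 hK h c hc (by omega)
  have hm := (mem_cellsD' r lam mu0 hlam _).1 c.2
  exact hno ⟨c.1.1, hm.1, by rw [a1]; exact a4, a2, by omega⟩

theorem FF_step {R : Type*} [CommRing R] {M K r : ℕ} {lam mu0 mu : ℕ → ℕ} (W : ℕ → R)
    (hlam : Antitone lam) (hmu : Antitone mu)
    (h0 : ∀ i, mu0 i ≤ mu i) (hK : ∀ c ∈ cellsD r lam mu0, dg r c < K) (s : ℕ) (hs : s < M * K)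
    (i : ℕ) (hi : i < r) (ht : mu i + (r - 1 - i) = s % K) (ha : Addable mu i)
    (hl : mu i < lam i) :
    FF M K r (cellsD r lam mu0) W mu s = FF M K r (cellsD r lam mu0) W mu (s + 1) +
      W s * FF M K r (cellsD r lam mu0) W (Function.update mu i (mu i + 1)) (s + 1) := by
  classical
  have hKpos : 0 < K := by
    rcases Nat.eq_zero_or_pos K with h | h
    · subst h; simp at hs
    · exact h
  have hkM : s / K < M := by
    rw [Nat.div_lt_iff_lt_mul hKpos]; exact hs
  have hMpos : 0 < M := lt_of_le_of_lt (Nat.zero_le _) hkM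
  set kk : Fin M := ⟨s / K, hkM⟩ with hkk
  have hsdm : s / K * K + s % K = s := by rw [mul_comm]; exact Nat.div_add_mod s K
  have hcX : (i, mu i) ∈ cellsD r lam mu0 := by
    rw [mem_cellsD' _ _ _ hlam]; exact ⟨hi, h0 i, hl⟩
  set c0 : cellsD r lam mu0 := ⟨(i, mu i), hcX⟩ with hc0
  have hdc0 : dg r c0.1 = s % K := ht
  set mu' := Function.update mu i (mu i + 1) with hmu'
  have hout : ∀ c : cellsD r lam mu0, mu' c.1.1 ≤ c.1.2 ↔ (mu c.1.1 ≤ c.1.2 ∧ c ≠ c0) := by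
    rintro ⟨⟨x, y⟩, hc⟩
    simp only [hmu', Function.update_apply, hc0, ne_eq, Subtype.mk.injEq, Prod.mk.injEq]
    split_ifs with h
    · subst h; omega
    · simp [h]
  have hin : ∀ c : cellsD r lam mu0, c.1.2 < mu' c.1.1 ↔ (c.1.2 < mu c.1.1 ∨ c = c0) := by
    intro c
    have := hout c
    rw [← not_iff_not]; push Not; exact this
  have hc0mu : mu c0.1.1 ≤ c0.1.2 := le_rfl
  have huniq : ∀ g : cellsD r lam mu0 → Fin M, PP M K r (cellsD r lam mu0) mu s g →
      ∀ c : cellsD r lam mu0, mu c.1.1 ≤ c.1.2 → (g c : ℕ) * K + dg r c.1 = s →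
        c = c0 ∧ g c = kk := by
    intro g hP c hc hcs
    obtain ⟨a1, a2, a3, a4⟩ := corner_of_min hlam h0 hK hP c hc hcs
    refine ⟨?_, Fin.ext a3⟩
    obtain ⟨⟨x, y⟩, hcX'⟩ := c
    simp only at a1 a4
    have hx := ((mem_cellsD' r lam mu0 hlam _).1 hcX').1
    simp only [dg] at a4 hx
    have hxi : x = i := by
      rcases lt_trichotomy x i with h | h | h
      · have := hmu h.le; omega
      · exact h
      · have := hmu h.le; omega
    subst hxi
    simp [hc0, a1]
  unfold FF
  rw [← Finset.sum_filter_add_sum_filter_not _ (fun g => g c0 ≠ kk)]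
  congr 1
  · congr 1
    ext g
    simp only [Finset.mem_filter, Finset.mem_univ, true_and]
    constructor
    · rintro ⟨h, hne⟩
      refine ⟨h.1, h.2.1, h.2.2.1, fun c hc => ?_⟩
      have h1 := h.2.2.2 c hc
      by_contra h2
      obtain ⟨b1, b2⟩ := huniq g h c hc (by omega)
      subst b1
      exact hne b2
    · intro h
      refine ⟨PP_mono h, fun he => ?_⟩
      have := h.2.2.2 c0 hc0mu
      rw [he, hdc0] at this
      simp only [hkk] at this
      omega
  · rw [Finset.mul_sum]
    refine Finset.sum_bij' (fun g _ => Function.update g c0 ⟨0, hMpos⟩)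
      (fun g _ => Function.update g c0 kk) ?_ ?_ ?_ ?_ ?_
    · intro g hg
      simp only [Finset.mem_filter, Finset.mem_univ, true_and, not_not] at hg ⊢
      obtain ⟨h, hk⟩ := hg
      refine ⟨?_, ?_, ?_, ?_⟩
      · intro c hc
        rw [Function.update_apply]
        split_ifs with hcc
        · rfl
        · exact h.1 c (((hin c).1 hc).resolve_right hcc)
      · intro c c' hc h1 h2
        have hc2 := (hout c).1 hc
        have hc2' : mu' c'.1.1 ≤ c'.1.2 := by rw [← h1]; omega
        have hc2' := (hout c').1 hc2'
        rw [Function.update_of_ne hc2.2, Function.update_of_ne hc2'.2]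
        exact h.2.1 c c' hc2.1 h1 h2
      · intro c c' hc hc' h1 h2
        have hc2 := (hout c).1 hc
        have hc2' := (hout c').1 hc'
        rw [Function.update_of_ne hc2.2, Function.update_of_ne hc2'.2]
        exact h.2.2.1 c c' hc2.1 hc2'.1 h1 h2
      · intro c hc
        have hc2 := (hout c).1 hc
        rw [Function.update_of_ne hc2.2]
        have := h.2.2.2 c hc2.1
        by_contra h2
        exact hc2.2 (huniq g h c hc2.1 (by omega)).1
    · intro g hg
      simp only [Finset.mem_filter, Finset.mem_univ, true_and, not_not] at hg ⊢
      refine ⟨⟨?_, ?_, ?_, ?_⟩, by simp⟩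
      · intro c hc
        have : c ≠ c0 := by rintro rfl; omega
        rw [Function.update_of_ne this]
        exact hg.1 c ((hin c).2 (Or.inl hc))
      · intro c c' hc h1 h2
        by_cases e' : c' = c0
        · have : c = c0 := by
            rw [e'] at h1 h2
            apply Subtype.ext
            apply Prod.ext h1
            rw [h1] at hc
            exact le_antisymm h2 hc
          rw [this, e']
        · rw [Function.update_of_ne e']
          by_cases e : c = c0
          · rw [e, Function.update_self]
            have hc' : mu c'.1.1 ≤ c'.1.2 := by rw [← h1]; omega
            have h3 := hg.2.2.2 c' ((hout c').2 ⟨hc', e'⟩)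
            have hd := hK _ c'.2
            rw [Fin.le_def]
            show s / K ≤ _
            by_contra hlt
            have := Nat.mul_le_mul_right K (show (g c' : ℕ) + 1 ≤ s / K by omega)
            rw [Nat.succ_mul] at this
            omega
          · rw [Function.update_of_ne e]
            exact hg.2.1 c c' ((hout c).2 ⟨hc, e⟩) h1 h2
      · intro c c' hc hc' h1 h2
        by_cases e' : c' = c0
        · exfalso
          rw [e'] at h1 h2
          have h1 : c.1.1 < i := h1
          have h2 : c.1.2 = mu i := h2
          rcases ha with ha | ha
          · omega
          · have := hmu (show c.1.1 ≤ i - 1 by omega)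
            omega
        · rw [Function.update_of_ne e']
          by_cases e : c = c0
          · rw [e, Function.update_self]
            have h3 := hg.2.2.2 c' ((hout c').2 ⟨hc', e'⟩)
            have hx := ((mem_cellsD' r lam mu0 hlam _).1 c'.2).1
            have hd : dg r c'.1 < s % K := by
              rw [← hdc0, ← e]
              unfold dg
              omega
            rw [Fin.lt_def]
            show s / K < _
            by_contra hlt
            have := Nat.mul_le_mul_right K (show (g c' : ℕ) ≤ s / K by omega)
            omega
          · rw [Function.update_of_ne e]
            exact hg.2.2.1 c c' ((hout c).2 ⟨hc, e⟩) ((hout c').2 ⟨hc', e'⟩) h1 h2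
      · intro c hc
        by_cases e : c = c0
        · rw [e, Function.update_self, hdc0]
          show s ≤ s / K * K + s % K
          omega
        · rw [Function.update_of_ne e]
          have := hg.2.2.2 c ((hout c).2 ⟨hc, e⟩)
          omega
    · intro g hg
      simp only [Finset.mem_filter, Finset.mem_univ, true_and, not_not] at hg
      rw [Function.update_idem, ← hg.2, Function.update_eq_self]
    · intro g hg
      simp only [Finset.mem_filter, Finset.mem_univ, true_and, not_not] at hg
      have : g c0 = ⟨0, hMpos⟩ := Fin.ext (hg.1 c0 ((hin c0).2 (Or.inr rfl)))
      rw [Function.update_idem, ← this, Function.update_eq_self]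
    · intro g hg
      simp only [Finset.mem_filter, Finset.mem_univ, true_and, not_not] at hg
      unfold wt
      rw [← Finset.mul_prod_erase _ _ (Finset.mem_univ c0),
        ← Finset.mul_prod_erase (a := c0) (f := fun c : cellsD r lam mu0 =>
          if mu' c.1.1 ≤ c.1.2 then
            W ((Function.update g c0 ⟨0, hMpos⟩ c : ℕ) * K + dg r c.1) else 1) _
            (Finset.mem_univ c0)]
      have e1 : ¬ (mu' c0.1.1 ≤ c0.1.2) := fun h => ((hout c0).1 h).2 rfl
      rw [if_pos hc0mu, if_neg e1, one_mul, hg.2, hdc0]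
      congr 1
      · rw [show ((kk : ℕ) * K + s % K) = s from hsdm]
      · apply Finset.prod_congr rfl
        intro c hc
        have hne : c ≠ c0 := Finset.ne_of_mem_erase hc
        rw [Function.update_of_ne hne]
        simp only [hout c, hne, ne_eq, not_false_eq_true, and_true]

open Classical in
theorem FF_end {R : Type*} [CommRing R] {M K r : ℕ} {lam mu0 mu : ℕ → ℕ} (W : ℕ → R)
    (hM : 0 < M) (hlam : Antitone lam) (h0 : ∀ i, mu0 i ≤ mu i) (hml : ∀ i, mu i ≤ lam i)
    (hl0 : ∀ i, r ≤ i → lam i = 0) (hK : ∀ c ∈ cellsD r lam mu0, dg r c < K) :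
    FF M K r (cellsD r lam mu0) W mu (M * K) = if mu = lam then 1 else 0 := by
  classical
  unfold FF
  split_ifs with h
  · subst h
    rw [Finset.sum_eq_single (fun _ => (⟨0, hM⟩ : Fin M))]
    · unfold wt
      apply Finset.prod_eq_one
      intro c _
      have := (mem_cellsD' r mu mu0 hlam _).1 c.2
      rw [if_neg (by omega)]
    · intro g hg hne
      exfalso
      simp only [Finset.mem_filter, Finset.mem_univ, true_and] at hg
      apply hne
      funext c
      have := (mem_cellsD' r mu mu0 hlam _).1 c.2
      exact Fin.ext (hg.1 c this.2.2)
    · intro hno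
      exfalso
      apply hno
      simp only [Finset.mem_filter, Finset.mem_univ, true_and]
      have hc : ∀ c : cellsD r mu mu0, ¬ mu c.1.1 ≤ c.1.2 := fun c => by
        have := (mem_cellsD' r mu mu0 hlam _).1 c.2
        omega
      exact ⟨fun _ _ => rfl, fun c _ h => absurd h (hc c), fun c _ h => absurd h (hc c),
        fun c h => absurd h (hc c)⟩
  · apply Finset.sum_eq_zero
    intro g hg
    exfalso
    simp only [Finset.mem_filter, Finset.mem_univ, true_and] at hg
    obtain ⟨i, hi⟩ := Function.ne_iff.1 h
    have hlt : mu i < lam i := lt_of_le_of_ne (hml i) hi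
    have hir : i < r := by
      by_contra hh
      have := hl0 i (by omega)
      omega
    have hcX : (i, mu i) ∈ cellsD r lam mu0 := by
      rw [mem_cellsD' _ _ _ hlam]; exact ⟨hir, h0 i, hlt⟩
    have a1 := hg.2.2.2 ⟨_, hcX⟩ le_rfl
    have a2 := hK _ hcX
    have a3 := Nat.mul_le_mul_right K (Nat.succ_le_of_lt (g ⟨_, hcX⟩).2)
    rw [Nat.succ_mul] at a3
    simp only at a1
    omega

theorem FF_eq {R : Type*} [CommRing R] {M N K r : ℕ} {lam mu0 : ℕ → ℕ} (W : ℕ → R)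
    (hM : 0 < M) (hlam : Antitone lam)
    (hl0 : ∀ i, r ≤ i → lam i = 0) (hb : ∀ a, maya lam r a < N)
    (hK : ∀ c ∈ cellsD r lam mu0, dg r c < K) (n : ℕ) :
    ∀ (s : ℕ) (mu : ℕ → ℕ), s + n = M * K → Antitone mu → (∀ i, mu0 i ≤ mu i) →
      (∀ i, mu i ≤ lam i) →
      FF M K r (cellsD r lam mu0) W mu s = SchurV (tailProd N K W s n) r lam mu := by
  induction n with
  | zero =>
    intro s mu hs hmu h0 hml
    have : tailProd N K W s 0 = 1 := by simp [tailProd]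
    have hm0 : ∀ i, r ≤ i → mu i = 0 := fun i hi => by
      have := hl0 i hi
      have := hml i
      omega
    rw [this, schurV_one r lam mu hlam hmu hl0 hm0 hb, show s = M * K by omega,
      FF_end W hM hlam h0 hml hl0 hK]
  | succ n ih =>
    intro s mu hs hmu h0 hml
    have hm0 : ∀ i, r ≤ i → mu i = 0 := fun i hi => by
      have := hl0 i hi
      have := hml i
      omega
    rw [tailProd_succ]
    by_cases h : ∃ i, i < r ∧ mu i + (r - 1 - i) = s % K ∧ Addable mu i
    · obtain ⟨i, hi, ht, ha⟩ := h
      rw [schurV_step_row _ _ _ r lam mu hmu i hi ht]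
      by_cases hl : mu i < lam i
      · rw [FF_step W hlam hmu h0 hK s (by omega) i hi ht ha hl,
          ih _ mu (by omega) hmu h0 hml,
          ih _ _ (by omega) (antitone_update mu hmu i ha)]
        · intro j
          rw [Function.update_apply]; split_ifs with h
          · subst h; exact (h0 j).trans (Nat.le_succ _)
          · exact h0 j
        · intro j
          rw [Function.update_apply]; split_ifs with h
          · subst h; omega
          · exact hml j
      · rw [FF_none W hlam h0 hK s, ih _ mu (by omega) hmu h0 hml,
          schurV_not_le N K W r lam hlam hl0 hb n _ _ (antitone_update mu hmu i ha)]
        · simp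
        · intro j hj
          rw [Function.update_of_ne (by omega)]; exact hm0 j hj
        · exact ⟨i, by rw [Function.update_self]; omega⟩
        · rintro ⟨j, hj, htj, _, hlj⟩
          have : j = i := by
            rcases lt_trichotomy j i with h | h | h
            · have := hmu h.le; omega
            · exact h
            · have := hmu h.le; omega
          subst this
          omega
    · rw [schurV_step_none _ _ _ r lam mu hmu h, FF_none W hlam h0 hK s,
        ih _ mu (by omega) hmu h0 hml]
      rintro ⟨j, hj, htj, haj, _⟩
      exact h ⟨j, hj, htj, haj⟩

theorem UmatW_eq {R : Type*} [CommRing R] (N M : ℕ) (r : ℤ) (w : ℕ → ℤ → R) :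
    UmatW N M r w = tailProd N (N - 1)
      (fun s => w (s / (N - 1) + 1) (((s % (N - 1) : ℕ) : ℤ) + 1 - r)) 0 (M * (N - 1)) := by
  unfold UmatW tailProd
  rw [← List.range_eq_range']
  induction M with
  | zero => simp
  | succ M ih =>
    rw [List.range_succ, List.map_append, List.prod_append, ih, Nat.succ_mul, List.range_add,
      List.map_append, List.prod_append]
    congr 1
    simp only [List.map_cons, List.map_nil, List.prod_cons, List.prod_nil, mul_one, List.map_map]
    congr 1
    apply List.map_congr_left
    intro t ht
    rw [List.mem_range] at ht
    have e1 : (M * (N - 1) + t) / (N - 1) = M := by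
      rw [mul_comm, Nat.mul_add_div (by omega), Nat.div_eq_of_lt ht]; rfl
    have e2 : (M * (N - 1) + t) % (N - 1) = t := by
      rw [mul_comm, Nat.mul_add_mod, Nat.mod_eq_of_lt ht]
    simp only [Function.comp, e1, e2]

end Helpers

/-- Truncated diagonally constant Schur multiple zeta values as ninth variations. -/
theorem truncated_schur_zeta_as_ninth_variation (M N : ℕ) (hM : 0 < M) (hN : 0 < N)
    (r m : ℤ) (a : ℤ → ℂ)
    (rm : ℕ) (hrm : (rm : ℤ) = r + m) (hrmN : rm ≤ N)
    (lam mu : ℕ → ℕ)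
    (hlam : ∀ i, lam (i + 1) ≤ lam i) (hmu : ∀ i, mu (i + 1) ≤ mu i)
    (hsub : ∀ i, mu i ≤ lam i)
    (hlen : ∀ i, rm ≤ i → lam i = 0) (hwid : lam 0 ≤ N - rm) :
    zetaT M rm lam mu (fun c => a (c + m)) =
      SchurV (UmatW N M r (fun k c => (k : ℂ) ^ (-(a c)))) rm lam mu := by
  have hlamA : Antitone lam := antitone_nat_of_succ_le hlam
  have hmuA : Antitone mu := antitone_nat_of_succ_le hmu
  have hb : ∀ x, maya lam rm x < N := by
    intro x
    unfold maya
    have := hlamA (Nat.zero_le (rm - 1 - (x : ℕ)))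
    omega
  have hK : ∀ c ∈ cellsD rm lam mu, dg rm c < N - 1 := by
    intro c hc
    rw [mem_cellsD' _ _ _ hlamA] at hc
    have := hlamA (Nat.zero_le c.1)
    unfold dg
    omega
  rw [UmatW_eq, ← FF_eq (mu0 := mu) _ hM hlamA hlen hb hK (M * (N - 1)) 0 mu (by omega) hmuA
    (fun _ => le_rfl) hsub]
  have hall : ∀ c : cellsD rm lam mu, mu c.1.1 ≤ c.1.2 := fun c =>
    ((mem_cellsD' rm lam mu hlamA _).1 c.2).2.1
  unfold zetaT zetaTF tabSum FF
  apply Finset.sum_congr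
  · ext g
    simp only [Finset.mem_filter, Finset.mem_univ, true_and]
    constructor
    · intro h
      exact ⟨fun c hc => absurd (hall c) (by omega), fun c c' _ => h.1 c c',
        fun c c' _ _ => h.2 c c', fun c _ => Nat.zero_le _⟩
    · intro h
      exact ⟨fun c c' => h.2.1 c c' (hall c), fun c c' => h.2.2.1 c c' (hall c) (hall c')⟩
  · intro g _
    unfold wt
    apply Finset.prod_congr rfl
    intro c _
    have hd := hK _ c.2
    have hc := ((mem_cellsD' rm lam mu hlamA _).1 c.2).1
    have e1 : ((g c : ℕ) * (N - 1) + dg rm c.1) / (N - 1) = g c := by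
      rw [mul_comm, Nat.mul_add_div (by omega), Nat.div_eq_of_lt hd]; rfl
    have e2 : ((g c : ℕ) * (N - 1) + dg rm c.1) % (N - 1) = dg rm c.1 := by
      rw [mul_comm, Nat.mul_add_mod, Nat.mod_eq_of_lt hd]
    rw [if_pos (hall c)]
    beta_reduce
    rw [e1, e2]
    have e3 : ((dg rm c.1 : ℕ) : ℤ) + 1 - r = (c.1.2 : ℤ) - (c.1.1 : ℤ) + m := by
      unfold dg; omega
    rw [e3]
end

section
/- Giambelli formula for truncated diagonally constant Schur multiple zeta values (Corollary 5.2): Let M be a positive integer, a : ℤ → ℂ, and λ ⊇ μ partitions with Frobenius notations λ = (α|β), α_1 > ⋯ > α_p ≥ 0, β_1 > ⋯ > β_p ≥ 0, and μ = (γ|δ), γ_1 > ⋯ > γ_q ≥ 0, δ_1 > ⋯ > δ_q ≥ 0. Then ζ^M_{λ/μ}(a) = (−1)^q · det of the (p+q)×(p+q) block matrix whose top-left p×p block has (i,j) entry ζ^M_{(α_i|β_j)}(a) (with (α_i|β_j) the hook partition (α_i+1, 1^{β_j})), whose top-right p×q block has (i,j) entry ζ^{⋆,M}(a(γ_j+1),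 a(γ_j+2), …, a(α_i)) when α_i > γ_j, equal to 1 when α_i = γ_j, and 0 when α_i < γ_j, whose bottom-left q×p block has (i,j) entry ζ^M(a(−δ_i−1), a(−δ_i−2), …, a(−β_j)) when β_j > δ_i, equal to 1 when β_j = δ_i, and 0 when β_j < δ_i, and whose bottom-right q×q block is zero. -/
open Matrix BigOperators Finset Filter

namespace GB

/-- content of a cell -/
def cont (c : ℕ × ℕ) : ℤ := (c.2 : ℤ) - (c.1 : ℤ)

/-- semistandardness on an arbitrary finite set of cells -/
def SS {M : ℕ} {S : Finset (ℕ × ℕ)} (T : ↥S → Fin M) : Prop :=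
  (∀ c c' : ↥S, c.val.1 = c'.val.1 → c.val.2 ≤ c'.val.2 → T c ≤ T c') ∧
  (∀ c c' : ↥S, c.val.1 < c'.val.1 → c.val.2 = c'.val.2 → T c < T c')

/-- value `v` is allowed in cell `c` before step `(m,t)` -/
def Alw (N : ℤ) (m : ℕ) (t : ℤ) (c : ℕ × ℕ) (v : ℕ) : Prop :=
  -N ≤ cont c ∧ cont c < N ∧ (v < m ∨ (v = m ∧ cont c < t))

variable {R : Type*} [CommRing R]

open Classical in
/-- restricted tableau sum -/
noncomputable def Zs (M : ℕ) (f : ℕ → ℤ → R) (N : ℤ) (m : ℕ) (t : ℤ) (S : Finset (ℕ × ℕ)) : R :=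
  ∑ T ∈ Finset.univ.filter (fun T : ↥S → Fin M => SS T ∧ ∀ c : ↥S, Alw N m t c.val (T c)),
    ∏ c : ↥S, f ((T c : ℕ) + 1) (cont c.val)

open Classical in
/-- restricted tableau sum for `L/U`, zero if not contained -/
noncomputable def Zt (M : ℕ) (f : ℕ → ℤ → R) (N : ℤ) (m : ℕ) (t : ℤ)
    (L U : Finset (ℕ × ℕ)) : R :=
  if U ⊆ L then Zs M f N m t (L \ U) else 0

/-- lower set of cells -/
def Low (L : Finset (ℕ × ℕ)) : Prop :=
  ∀ c d : ℕ × ℕ, c.1 ≤ d.1 → c.2 ≤ d.2 → d ∈ L → c ∈ L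

/-- removable corner -/
def Corner (L : Finset (ℕ × ℕ)) (c : ℕ × ℕ) : Prop :=
  c ∈ L ∧ (c.1 + 1, c.2) ∉ L ∧ (c.1, c.2 + 1) ∉ L

lemma corner_unique {L : Finset (ℕ × ℕ)} (hL : Low L) {c d : ℕ × ℕ} (hc : Corner L c)
    (hd : Corner L d) (h : cont c = cont d) : c = d := by
  obtain ⟨c1, c2⟩ := c
  obtain ⟨d1, d2⟩ := d
  simp only [cont] at h
  rcases lt_trichotomy c1 d1 with h1 | h1 | h1
  · exact absurd (hL (c1 + 1, c2) (d1, d2) (by simp; omega) (by simp; omega) hd.1) hc.2.1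
  · have : c2 = d2 := by omega
    simp [h1, this]
  · exact absurd (hL (d1 + 1, d2) (c1, c2) (by simp; omega) (by simp; omega) hc.1) hd.2.1

lemma corner_row {L : Finset (ℕ × ℕ)} (hL : Low L) {c d : ℕ × ℕ} (hc : Corner L c)
    (hd : d ∈ L) (h1 : c.1 ≤ d.1) (h2 : c.2 ≤ d.2) : d = c := by
  obtain ⟨c1, c2⟩ := c
  obtain ⟨d1, d2⟩ := d
  simp only at h1 h2
  by_cases h : c1 = d1
  · by_cases h' : c2 = d2
    · simp [h, h']
    · exact absurd (hL (c1, c2 + 1) (d1, d2) (by simp; omega) (by simp; omega) hd) hc.2.2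
  · exact absurd (hL (c1 + 1, c2) (d1, d2) (by simp; omega) (by simp; omega) hd) hc.2.1

lemma key {M : ℕ} {N : ℤ} {m : ℕ} {t : ℤ} {L U : Finset (ℕ × ℕ)} (hU : Low U)
    {T : ↥(L \ U) → Fin M} (hT : SS T) (hA : ∀ c : ↥(L \ U), Alw N m (t + 1) c.val (T c))
    (c : ↥(L \ U)) (hc : cont c.val = t) (hm : (T c : ℕ) = m) : Corner L c.val := by
  have hcS := Finset.mem_sdiff.1 c.2
  refine ⟨hcS.1, fun h => ?_, fun h => ?_⟩
  · have hS : (c.val.1 + 1, c.val.2) ∈ L \ U :=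
      Finset.mem_sdiff.2 ⟨h, fun h' => hcS.2 (hU c.val _ (by simp) (by simp) h')⟩
    have h1 := hT.2 c ⟨_, hS⟩ (by simp) (by simp)
    have h2 := (hA ⟨_, hS⟩).2.2
    have h3 : (T c : ℕ) < T ⟨_, hS⟩ := h1
    omega
  · have hS : (c.val.1, c.val.2 + 1) ∈ L \ U :=
      Finset.mem_sdiff.2 ⟨h, fun h' => hcS.2 (hU c.val _ (by simp) (by simp) h')⟩
    have h1 := hT.1 c ⟨_, hS⟩ (by simp) (by simp)
    have h2 := (hA ⟨_, hS⟩).2.2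
    have h3 : (T c : ℕ) ≤ T ⟨_, hS⟩ := h1
    simp only [cont] at h2 hc
    push_cast at h2
    omega

lemma Alw.mono {N : ℤ} {m : ℕ} {t : ℤ} {c : ℕ × ℕ} {v : ℕ} (h : Alw N m t c v) :
    Alw N m (t + 1) c v := by
  obtain ⟨h1, h2, h3⟩ := h
  refine ⟨h1, h2, ?_⟩
  omega

lemma Alw.down {N : ℤ} {m : ℕ} {t : ℤ} {c : ℕ × ℕ} {v : ℕ} (h : Alw N m (t + 1) c v)
    (h' : ¬ (cont c = t ∧ v = m)) : Alw N m t c v := by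
  obtain ⟨h1, h2, h3⟩ := h
  refine ⟨h1, h2, ?_⟩
  omega

lemma Zs_noCorner (M : ℕ) (f : ℕ → ℤ → R) (N : ℤ) (m : ℕ) (t : ℤ) {L U : Finset (ℕ × ℕ)}
    (hU : Low U) (h : ∀ c ∈ L \ U, Corner L c → cont c ≠ t) :
    Zs M f N m (t + 1) (L \ U) = Zs M f N m t (L \ U) := by
  classical
  unfold Zs
  congr 1
  ext T
  simp only [Finset.mem_filter, Finset.mem_univ, true_and]
  constructor
  · rintro ⟨hT, hA⟩
    refine ⟨hT, fun c => (hA c).down ?_⟩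
    rintro ⟨h1, h2⟩
    exact h c.val c.2 (key hU hT hA c h1 h2) h1
  · rintro ⟨hT, hA⟩
    exact ⟨hT, fun c => (hA c).mono⟩

lemma Zs_corner (M : ℕ) (f : ℕ → ℤ → R) (N : ℤ) (m : ℕ) (hm : m < M) (t : ℤ)
    (ht : -N ≤ t) (ht' : t < N) {L U : Finset (ℕ × ℕ)}
    (hL : Low L) (hU : Low U) (c : ℕ × ℕ) (hc : Corner L c) (hcU : c ∉ U) (hct : cont c = t) :
    Zs M f N m (t + 1) (L \ U) =
      Zs M f N m t (L \ U) + f (m + 1) t * Zs M f N m t (L.erase c \ U) := by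
  classical
  have hcS : c ∈ L \ U := Finset.mem_sdiff.2 ⟨hc.1, hcU⟩
  have hsub : ∀ x, x ∈ L.erase c \ U → x ∈ L \ U := by
    intro x hx
    simp only [Finset.mem_sdiff, Finset.mem_erase] at hx ⊢
    tauto
  have hne : ∀ x, x ∈ L.erase c \ U → x ≠ c := by
    intro x hx
    simp only [Finset.mem_sdiff, Finset.mem_erase] at hx
    tauto
  have hback : ∀ x, x ∈ L \ U → x ≠ c → x ∈ L.erase c \ U := by
    intro x hx
    simp only [Finset.mem_sdiff, Finset.mem_erase] at hx ⊢
    tauto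
  unfold Zs
  rw [← Finset.sum_filter_add_sum_filter_not _
    (fun T : ↥(L \ U) → Fin M => ((T ⟨c, hcS⟩ : Fin M) : ℕ) = m), add_comm]
  congr 1
  · apply Finset.sum_congr _ (fun _ _ => rfl)
    ext T
    simp only [Finset.mem_filter, Finset.mem_univ, true_and]
    constructor
    · rintro ⟨⟨hT, hA⟩, hTc⟩
      refine ⟨hT, fun x => (hA x).down ?_⟩
      rintro ⟨h1, h2⟩
      have := corner_unique hL (key hU hT hA x h1 h2) hc (h1.trans hct.symm)
      have h3 : x = ⟨c, hcS⟩ := Subtype.ext this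
      exact hTc (h3 ▸ h2)
    · rintro ⟨hT, hA⟩
      refine ⟨⟨hT, fun c => (hA c).mono⟩, fun h => ?_⟩
      have := (hA ⟨c, hcS⟩).2.2
      simp only at this
      omega
  · rw [Finset.mul_sum]
    refine Finset.sum_bij' (fun T _ => fun x => T ⟨x.val, hsub _ x.2⟩)
      (fun T _ => fun x => if h : x.val = c then ⟨m, hm⟩ else T ⟨x.val, hback _ x.2 h⟩)
      ?_ ?_ ?_ ?_ ?_
    · intro T hT
      simp only [Finset.mem_filter, Finset.mem_univ, true_and] at hT ⊢
      obtain ⟨⟨hT, hA⟩, hTc⟩ := hT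
      refine ⟨⟨fun x y h1 h2 => hT.1 _ _ h1 h2, fun x y h1 h2 => hT.2 _ _ h1 h2⟩, fun x => ?_⟩
      refine (hA ⟨x.val, hsub _ x.2⟩).down ?_
      rintro ⟨h1, h2⟩
      exact hne _ x.2 (corner_unique hL (key hU hT hA _ h1 h2) hc (h1.trans hct.symm))
    · intro T hT
      simp only [Finset.mem_filter, Finset.mem_univ, true_and] at hT ⊢
      obtain ⟨hT, hA⟩ := hT
      refine ⟨⟨⟨?_, ?_⟩, ?_⟩, by simp⟩
      · rintro ⟨x, hx⟩ ⟨y, hy⟩ h1 h2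
        simp only at h1 h2 ⊢
        by_cases hxc : x = c
        · have : y = c := by
            subst hxc
            exact corner_row hL hc (Finset.mem_sdiff.1 hy).1 h1.le h2
          simp [hxc, this]
        · by_cases hyc : y = c
          · have := (hA ⟨x, hback _ hx hxc⟩).2.2
            simp only [hxc, hyc, dif_pos, dif_neg, not_false_eq_true]
            show (T _ : ℕ) ≤ m
            omega
          · simp only [hxc, hyc, dif_neg, not_false_eq_true]
            exact hT.1 _ _ h1 h2
      · rintro ⟨x, hx⟩ ⟨y, hy⟩ h1 h2
        simp only at h1 h2 ⊢
        by_cases hxc : x = c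
        · exfalso
          subst hxc
          have := corner_row hL hc (Finset.mem_sdiff.1 hy).1 h1.le h2.le
          subst this
          omega
        · by_cases hyc : y = c
          · have := (hA ⟨x, hback _ hx hxc⟩).2.2
            simp only [hxc, hyc, dif_pos, dif_neg, not_false_eq_true]
            show (T _ : ℕ) < m
            subst hyc
            simp only [cont] at this hct
            omega
          · simp only [hxc, hyc, dif_neg, not_false_eq_true]
            exact hT.2 _ _ h1 h2
      · rintro ⟨x, hx⟩
        simp only
        by_cases hxc : x = c
        · simp only [hxc, dif_pos]
          exact ⟨by omega, by omega, by omega⟩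
        · simp only [hxc, dif_neg, not_false_eq_true]
          exact (hA ⟨x, hback _ hx hxc⟩).mono
    · intro T hT
      simp only [Finset.mem_filter, Finset.mem_univ, true_and] at hT
      funext x
      by_cases hxc : x.val = c
      · have : x = ⟨c, hcS⟩ := Subtype.ext hxc
        subst this
        simp only [dif_pos]
        exact Fin.ext hT.2.symm
      · simp [hxc]
    · intro T hT
      funext x
      simp [hne _ x.2]
    · intro T hT
      simp only [Finset.mem_filter, Finset.mem_univ, true_and] at hT
      rw [← Finset.mul_prod_erase Finset.univ _ (Finset.mem_univ (⟨c, hcS⟩ : ↥(L \ U)))]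
      rw [hT.2, hct]
      congr 1
      refine Finset.prod_bij' (fun x hx => ⟨x.val, hback _ x.2 fun h =>
          (Finset.mem_erase.1 hx).1 (Subtype.ext h)⟩)
        (fun x _ => ⟨x.val, hsub _ x.2⟩) ?_ ?_ ?_ ?_ ?_
      · intro x hx
        exact Finset.mem_univ _
      · intro x hx
        refine Finset.mem_erase.2 ⟨fun h => hne _ x.2 (congrArg Subtype.val h), Finset.mem_univ _⟩
      · intro x hx
        rfl
      · intro x hx
        rfl
      · intro x hx
        rfl

lemma Zt_noCorner (M : ℕ) (f : ℕ → ℤ → R) (N : ℤ) (m : ℕ) (t : ℤ) {L U : Finset (ℕ × ℕ)}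
    (hU : Low U) (h : ∀ c, Corner L c → cont c ≠ t) :
    Zt M f N m (t + 1) L U = Zt M f N m t L U := by
  unfold Zt
  rw [Zs_noCorner M f N m t hU fun c _ => h c]

lemma Zt_corner (M : ℕ) (f : ℕ → ℤ → R) (N : ℤ) (m : ℕ) (hm : m < M) (t : ℤ)
    (ht : -N ≤ t) (ht' : t < N) {L U : Finset (ℕ × ℕ)}
    (hL : Low L) (hU : Low U) (c : ℕ × ℕ) (hc : Corner L c) (hct : cont c = t) :
    Zt M f N m (t + 1) L U =
      Zt M f N m t L U + f (m + 1) t * Zt M f N m t (L.erase c) U := by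
  unfold Zt
  by_cases h : U ⊆ L
  · by_cases hcU : c ∈ U
    · have h2 : ¬ U ⊆ L.erase c := fun h' => by simpa using h' hcU
      rw [if_pos h, if_pos h, if_neg h2, mul_zero, add_zero]
      refine Zs_noCorner M f N m t hU ?_
      intro d hd hd' hdt
      have := corner_unique hL hd' hc (hdt.trans hct.symm)
      subst this
      exact (Finset.mem_sdiff.1 hd).2 hcU
    · have h2 : U ⊆ L.erase c := fun x hx =>
        Finset.mem_erase.2 ⟨fun h' => hcU (h' ▸ hx), h hx⟩
      rw [if_pos h, if_pos h, if_pos h2]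
      exact Zs_corner M f N m hm t ht ht' hL hU c hc hcU hct
  · have h2 : ¬ U ⊆ L.erase c := fun h' => h (h'.trans (Finset.erase_subset _ _))
    simp [h, h2]

lemma Zt_next (M : ℕ) (f : ℕ → ℤ → R) (N : ℤ) (m : ℕ) (L U : Finset (ℕ × ℕ)) :
    Zt M f N (m + 1) (-N) L U = Zt M f N m N L U := by
  classical
  unfold Zt Zs
  congr 2
  ext T
  simp only [Finset.mem_filter, Finset.mem_univ, true_and]
  refine and_congr_right fun _ => forall_congr' fun c => ?_
  unfold Alw
  omega

lemma Zt_zero (M : ℕ) (f : ℕ → ℤ → R) (N : ℤ) (L U : Finset (ℕ × ℕ)) :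
    Zt M f N 0 (-N) L U = if L = U then 1 else 0 := by
  classical
  unfold Zt
  by_cases h : L = U
  · subst h
    simp only [Finset.Subset.refl, if_true]
    unfold Zs
    have : IsEmpty ↥(L \ L) := ⟨fun x => by simpa using x.2⟩
    rw [Finset.sum_eq_card_nsmul (b := 1)]
    · rw [Finset.filter_true_of_mem]
      · simp
      · intro T _
        exact ⟨⟨fun c => isEmptyElim c, fun c => isEmptyElim c⟩, fun c => isEmptyElim c⟩
    · intro T _
      simp
  · rw [if_neg h]
    split_ifs with h2
    · unfold Zs
      rw [Finset.sum_eq_zero]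
      intro T hT
      exfalso
      obtain ⟨x, hx⟩ := Finset.sdiff_nonempty.2 (fun h3 => h (Finset.Subset.antisymm h3 h2))
      have := ((Finset.mem_filter.1 hT).2.2 ⟨x, hx⟩)
      unfold Alw at this
      omega
    · rfl

/-- The diagram with Frobenius coordinates `(α|β)`. -/
def Fr (p : ℕ) (α β : Fin p → ℕ) : Finset (ℕ × ℕ) :=
  Finset.univ.biUnion fun i : Fin p =>
    (Finset.range (α i + 1)).image (fun k => ((i : ℕ), (i : ℕ) + k)) ∪
    (Finset.range (β i + 1)).image (fun k => ((i : ℕ) + k, (i : ℕ)))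

lemma mem_Fr {p : ℕ} {α β : Fin p → ℕ} {c : ℕ × ℕ} : c ∈ Fr p α β ↔
    (c.1 ≤ c.2 ∧ ∃ h : c.1 < p, c.2 ≤ α ⟨c.1, h⟩ + c.1) ∨
    (c.2 ≤ c.1 ∧ ∃ h : c.2 < p, c.1 ≤ β ⟨c.2, h⟩ + c.2) := by
  obtain ⟨x, y⟩ := c
  simp only [Fr, Finset.mem_biUnion, Finset.mem_univ, true_and, Finset.mem_union,
    Finset.mem_image, Finset.mem_range, Prod.mk.injEq]
  constructor
  · rintro ⟨i, ⟨k, hk, rfl, rfl⟩ | ⟨k, hk, rfl, rfl⟩⟩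
    · left
      exact ⟨by omega, i.2, by simp only [Fin.eta]; omega⟩
    · right
      exact ⟨by omega, i.2, by simp only [Fin.eta]; omega⟩
  · rintro (⟨h1, h2, h3⟩ | ⟨h1, h2, h3⟩)
    · exact ⟨⟨x, h2⟩, Or.inl ⟨y - x, by omega, rfl, by simp only; omega⟩⟩
    · exact ⟨⟨y, h2⟩, Or.inr ⟨x - y, by omega, by simp only; omega, rfl⟩⟩

lemma mem_Fr_swap {p : ℕ} {α β : Fin p → ℕ} {x y : ℕ} :
    (x, y) ∈ Fr p α β ↔ (y, x) ∈ Fr p β α := by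
  rw [mem_Fr, mem_Fr]
  exact or_comm

lemma mem_Fr_le {p : ℕ} {α β : Fin p → ℕ} {x y : ℕ} (h : x < y) : (x, y) ∈ Fr p α β ↔
    ∃ h : x < p, y ≤ α ⟨x, h⟩ + x := by
  rw [mem_Fr]
  simp only
  constructor
  · rintro (h1 | h1)
    · exact h1.2
    · omega
  · intro h1
    exact Or.inl ⟨h.le, h1⟩

lemma mem_Fr_ge {p : ℕ} {α β : Fin p → ℕ} {x y : ℕ} (h : y < x) : (x, y) ∈ Fr p α β ↔
    ∃ h : y < p, x ≤ β ⟨y, h⟩ + y := by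
  rw [mem_Fr_swap, mem_Fr_le h]

lemma mem_Fr_diag {p : ℕ} {α β : Fin p → ℕ} {x : ℕ} : (x, x) ∈ Fr p α β ↔ x < p := by
  rw [mem_Fr]
  simp

lemma anti_add {p : ℕ} {α : Fin p → ℕ} (hα : StrictAnti α) (i j : ℕ) (hij : i ≤ j) (hi : i < p)
    (hj : j < p) : α ⟨j, hj⟩ + j ≤ α ⟨i, hi⟩ + i := by
  induction j, hij using Nat.le_induction with
  | base => exact le_rfl
  | succ k hk ih =>
    have h1 := ih (by omega)
    have h2 : α ⟨k + 1, hj⟩ < α ⟨k, by omega⟩ := hα (by simp [Fin.lt_def])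
    omega

lemma low_Fr {p : ℕ} {α β : Fin p → ℕ} (hα : StrictAnti α) (hβ : StrictAnti β) :
    Low (Fr p α β) := by
  rintro ⟨c1, c2⟩ ⟨d1, d2⟩ h1 h2 hd
  simp only at h1 h2
  rw [mem_Fr] at hd ⊢
  simp only at hd ⊢
  rcases hd with ⟨h3, h4, h5⟩ | ⟨h3, h4, h5⟩
  · rcases le_total c1 c2 with h6 | h6
    · left
      have := anti_add hα c1 d1 h1 (by omega) h4
      exact ⟨h6, by omega, by omega⟩
    · right
      have := anti_add hβ c2 d1 (by omega) (by omega) h4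
      exact ⟨h6, by omega, by omega⟩
  · rcases le_total c1 c2 with h6 | h6
    · left
      have := anti_add hα c1 d2 (by omega) (by omega) h4
      exact ⟨h6, by omega, by omega⟩
    · right
      have := anti_add hβ c2 d2 h2 (by omega) h4
      exact ⟨h6, by omega, by omega⟩

lemma corner_pos {p : ℕ} {α β : Fin p → ℕ} (hα : StrictAnti α) {s : ℕ} {i : Fin p}
    (hi : α i = s + 1) (hs : ∀ j, α j ≠ s) :
    Corner (Fr p α β) ((i : ℕ), (i : ℕ) + s + 1) := by
  refine ⟨?_, ?_, ?_⟩
  · rw [mem_Fr_le (by omega)]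
    exact ⟨i.2, by simp only [Fin.eta]; omega⟩
  · simp only
    intro h
    rcases Nat.eq_zero_or_pos s with h0 | h0
    · subst h0
      rw [mem_Fr_diag] at h
      have h1 : α ⟨i + 1, h⟩ < α i := hα (by simp [Fin.lt_def])
      have := hs ⟨i + 1, h⟩
      omega
    · rw [mem_Fr_le (by omega)] at h
      obtain ⟨h1, h2⟩ := h
      have h3 : α ⟨i + 1, h1⟩ < α i := hα (by simp [Fin.lt_def])
      have := hs ⟨i + 1, h1⟩
      omega
  · simp only
    rw [mem_Fr_le (by omega)]
    rintro ⟨h1, h2⟩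
    simp only [Fin.eta] at h2
    omega

lemma noCorner_pos {p : ℕ} {α β : Fin p → ℕ} (hα : StrictAnti α) {s : ℕ}
    (h : (∀ i, α i ≠ s + 1) ∨ ∃ j, α j = s) (c : ℕ × ℕ) (hc : Corner (Fr p α β) c) :
    cont c ≠ ((s : ℤ) + 1) := by
  intro hct
  obtain ⟨x, y⟩ := c
  simp only [cont] at hct
  obtain ⟨h1, h2, h3⟩ := hc
  simp only at h2 h3
  have hy : y = x + s + 1 := by omega
  subst hy
  rw [mem_Fr_le (by omega)] at h1 h3
  obtain ⟨hx, h1⟩ := h1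
  have hax : α ⟨x, hx⟩ = s + 1 := by
    by_contra hne
    exact h3 ⟨hx, by omega⟩
  rcases h with h | ⟨j, hj⟩
  · exact h _ hax
  · have hlt : x < j := by
      by_contra hle
      have := hα.antitone (show j ≤ ⟨x, hx⟩ from by rw [Fin.le_def]; simp only; omega)
      omega
    have h4 := anti_add hα (x + 1) j (by omega) (by omega) j.2
    simp only [Fin.eta] at h4
    have h5 : α ⟨x + 1, by omega⟩ < α ⟨x, hx⟩ := hα (by simp [Fin.lt_def])
    have h6 : j ≤ ⟨x + 1, by omega⟩ ∨ x + 1 < j := by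
      rw [Fin.le_def]; simp only; omega
    have h7 : α ⟨x + 1, by omega⟩ ≥ s := by
      have := hα.antitone (show (⟨x + 1, by omega⟩ : Fin p) ≤ j from by
        rw [Fin.le_def]; simp only; omega)
      omega
    apply h2
    rcases Nat.eq_zero_or_pos s with h0 | h0
    · subst h0
      rw [mem_Fr_diag]
      omega
    · rw [mem_Fr_le (by omega)]
      exact ⟨by omega, by omega⟩

lemma erase_pos {p : ℕ} {α β : Fin p → ℕ} {s : ℕ} {i : Fin p}
    (hi : α i = s + 1) :
    (Fr p α β).erase ((i : ℕ), (i : ℕ) + s + 1) = Fr p (Function.update α i s) β := by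
  ext ⟨x, y⟩
  rw [Finset.mem_erase, mem_Fr, mem_Fr]
  simp only [ne_eq, Prod.mk.injEq]
  by_cases hx : x = i
  · subst hx
    simp only [Fin.eta, Function.update_self, hi, true_and]
    constructor
    · rintro ⟨h1, ⟨h2, h3, h4⟩ | h2⟩
      · exact Or.inl ⟨h2, h3, by omega⟩
      · exact Or.inr h2
    · rintro (⟨h2, h3, h4⟩ | h2)
      · exact ⟨by omega, Or.inl ⟨h2, h3, by omega⟩⟩
      · exact ⟨by have := h2.1; omega, Or.inr h2⟩
  · have hu : ∀ h : x < p, Function.update α i s ⟨x, h⟩ = α ⟨x, h⟩ := by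
      intro h
      rw [Function.update_of_ne]
      intro h'
      exact hx (congrArg Fin.val h')
    simp only [hu, hx, false_and, not_false_eq_true, true_and]

lemma strict_update {p : ℕ} {α : Fin p → ℕ} (hα : StrictAnti α) {s : ℕ} {i : Fin p}
    (hi : α i = s + 1) (hs : ∀ j, α j ≠ s) : StrictAnti (Function.update α i s) := by
  intro x y hxy
  by_cases hx : x = i
  · subst hx
    have hy : y ≠ x := hxy.ne'
    rw [Function.update_self, Function.update_of_ne hy]
    have := hα hxy
    have := hs y
    omega
  · rw [Function.update_of_ne hx]
    by_cases hy : y = i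
    · subst hy
      rw [Function.update_self]
      have := hα hxy
      omega
    · rw [Function.update_of_ne hy]
      exact hα hxy

lemma corner_swap {p : ℕ} {α β : Fin p → ℕ} {x y : ℕ} :
    Corner (Fr p α β) (x, y) ↔ Corner (Fr p β α) (y, x) := by
  unfold Corner
  simp only
  rw [mem_Fr_swap, mem_Fr_swap (x := x + 1), mem_Fr_swap (x := x) (y := y + 1)]
  tauto

lemma erase_neg {p : ℕ} {α β : Fin p → ℕ} {s : ℕ} {i : Fin p}
    (hi : β i = s + 1) :
    (Fr p α β).erase ((i : ℕ) + s + 1, (i : ℕ)) = Fr p α (Function.update β i s) := by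
  ext ⟨x, y⟩
  rw [mem_Fr_swap, ← erase_pos hi, Finset.mem_erase, Finset.mem_erase, mem_Fr_swap]
  simp only [ne_eq, Prod.mk.injEq]
  tauto

lemma noCorner_neg {p : ℕ} {α β : Fin p → ℕ} (hβ : StrictAnti β) {s : ℕ}
    (h : (∀ i, β i ≠ s + 1) ∨ ∃ j, β j = s) (c : ℕ × ℕ) (hc : Corner (Fr p α β) c) :
    cont c ≠ -((s : ℤ) + 1) := by
  obtain ⟨x, y⟩ := c
  have := noCorner_pos hβ h _ (corner_swap.1 hc)
  simp only [cont] at this ⊢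
  omega

lemma noCorner_zero {p : ℕ} {α β : Fin p → ℕ} (h : ∀ i, ¬ (α i = 0 ∧ β i = 0))
    (c : ℕ × ℕ) (hc : Corner (Fr p α β) c) : cont c ≠ 0 := by
  obtain ⟨x, y⟩ := c
  simp only [cont]
  intro hct
  have hy : y = x := by omega
  subst hy
  obtain ⟨h1, h2, h3⟩ := hc
  simp only at h2 h3
  rw [mem_Fr_diag] at h1
  rw [mem_Fr_ge (by omega)] at h2
  rw [mem_Fr_le (by omega)] at h3
  apply h ⟨y, h1⟩
  constructor
  · by_contra hne
    exact h3 ⟨h1, by omega⟩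
  · by_contra hne
    exact h2 ⟨h1, by omega⟩

lemma corner_zero {p : ℕ} {α β : Fin (p + 1) → ℕ} (h1 : α (Fin.last p) = 0)
    (h2 : β (Fin.last p) = 0) : Corner (Fr (p + 1) α β) (p, p) := by
  have h1' : ∀ h, α ⟨p, h⟩ = 0 := fun _ => h1
  have h2' : ∀ h, β ⟨p, h⟩ = 0 := fun _ => h2
  refine ⟨?_, ?_, ?_⟩
  · rw [mem_Fr_diag]
    omega
  · simp only
    rw [mem_Fr_ge (by omega)]
    rintro ⟨h3, h4⟩
    rw [h2'] at h4
    omega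
  · simp only
    rw [mem_Fr_le (by omega)]
    rintro ⟨h3, h4⟩
    rw [h1'] at h4
    omega

lemma erase_zero {p : ℕ} {α β : Fin (p + 1) → ℕ} (h1 : α (Fin.last p) = 0)
    (h2 : β (Fin.last p) = 0) : (Fr (p + 1) α β).erase (p, p) =
      Fr p (fun i => α i.castSucc) (fun i => β i.castSucc) := by
  have h1' : ∀ h, α ⟨p, h⟩ = 0 := fun _ => h1
  have h2' : ∀ h, β ⟨p, h⟩ = 0 := fun _ => h2
  ext ⟨x, y⟩
  rw [Finset.mem_erase, mem_Fr, mem_Fr]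
  simp only [ne_eq, Prod.mk.injEq, Fin.castSucc_mk]
  constructor
  · rintro ⟨h3, ⟨h4, h5, h6⟩ | ⟨h4, h5, h6⟩⟩
    · left
      have : x ≠ p := by
        rintro rfl
        rw [h1'] at h6
        omega
      exact ⟨h4, by omega, h6⟩
    · right
      have : y ≠ p := by
        rintro rfl
        rw [h2'] at h6
        omega
      exact ⟨h4, by omega, h6⟩
  · rintro (⟨h4, h5, h6⟩ | ⟨h4, h5, h6⟩)
    · exact ⟨by omega, Or.inl ⟨h4, by omega, h6⟩⟩
    · exact ⟨by omega, Or.inr ⟨h4, by omega, h6⟩⟩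

lemma Fr_inj {p q : ℕ} {α β : Fin p → ℕ} {γ δ : Fin q → ℕ} (h : Fr p α β = Fr q γ δ) :
    p = q ∧ (∀ i hi hi', α ⟨i, hi⟩ = γ ⟨i, hi'⟩) ∧ ∀ i hi hi', β ⟨i, hi⟩ = δ ⟨i, hi'⟩ := by
  have key : ∀ x y, (x, y) ∈ Fr p α β ↔ (x, y) ∈ Fr q γ δ := by
    intro x y
    rw [h]
  refine ⟨?_, ?_, ?_⟩
  · have h1 := key p p
    have h2 := key q q
    rw [mem_Fr_diag, mem_Fr_diag] at h1 h2
    omega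
  · intro i hi hi'
    apply le_antisymm
    · by_contra hlt
      have := (key i (α ⟨i, hi⟩ + i)).1 (by rw [mem_Fr_le (by omega)]; exact ⟨hi, le_rfl⟩)
      rw [mem_Fr_le (by omega)] at this
      obtain ⟨_, h3⟩ := this
      omega
    · by_contra hlt
      have := (key i (γ ⟨i, hi'⟩ + i)).2 (by rw [mem_Fr_le (by omega)]; exact ⟨hi', le_rfl⟩)
      rw [mem_Fr_le (by omega)] at this
      obtain ⟨_, h3⟩ := this
      omega
  · intro i hi hi'
    apply le_antisymm
    · by_contra hlt
      have := (key (β ⟨i, hi⟩ + i) i).1 (by rw [mem_Fr_ge (by omega)]; exact ⟨hi, le_rfl⟩)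
      rw [mem_Fr_ge (by omega)] at this
      obtain ⟨_, h3⟩ := this
      omega
    · by_contra hlt
      have := (key (δ ⟨i, hi'⟩ + i) i).2 (by rw [mem_Fr_ge (by omega)]; exact ⟨hi', le_rfl⟩)
      rw [mem_Fr_ge (by omega)] at this
      obtain ⟨_, h3⟩ := this
      omega

/-- The Giambelli block matrix with abstract entries. -/
def Gm (p q : ℕ) (H : ℕ → ℕ → R) (S : ℕ → Fin q → R) (E : Fin q → ℕ → R) (α β : Fin p → ℕ) :
    Matrix (Fin p ⊕ Fin q) (Fin p ⊕ Fin q) R :=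
  Matrix.fromBlocks (Matrix.of fun i j => H (α i) (β j)) (Matrix.of fun i j => S (α i) j)
    (Matrix.of fun i j => E i (β j)) 0

lemma Gm_transpose (p q : ℕ) (H : ℕ → ℕ → R) (S : ℕ → Fin q → R) (E : Fin q → ℕ → R)
    (α β : Fin p → ℕ) :
    (Gm p q H S E α β).det =
      (Gm p q (fun a b => H b a) (fun b i => E i b) (fun j a => S a j) β α).det := by
  rw [← Matrix.det_transpose]
  unfold Gm
  rw [Matrix.fromBlocks_transpose]
  rfl

lemma Gm_row {p q : ℕ} {H H' : ℕ → ℕ → R} {S S' : ℕ → Fin q → R} (E : Fin q → ℕ → R)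
    {α : Fin p → ℕ} (β : Fin p → ℕ) (hα : Function.Injective α) (s : ℕ) (w : R)
    (hH : ∀ a b, a ≠ s + 1 → H' a b = H a b) (hH' : ∀ b, H' (s + 1) b = H (s + 1) b + w * H s b)
    (hS : ∀ a j, a ≠ s + 1 → S' a j = S a j) (hS' : ∀ j, S' (s + 1) j = S (s + 1) j + w * S s j)
    (i : Fin p) (hi : α i = s + 1) :
    (Gm p q H' S' E α β).det =
      (Gm p q H S E α β).det + w * (Gm p q H S E (Function.update α i s) β).det := by
  have hu : Gm p q H S E (Function.update α i s) β = (Gm p q H S E α β).updateRow (Sum.inl i)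
      (Gm p q H S E (Function.update α i s) β (Sum.inl i)) := by
    ext x y
    rcases x with x | x
    · by_cases hx : x = i
      · subst hx
        rw [Matrix.updateRow_self]
      · rw [Matrix.updateRow_ne (by simpa using hx)]
        rcases y with y | y <;> simp [Gm, Function.update_of_ne hx]
    · rw [Matrix.updateRow_ne (by simp)]
      rcases y with y | y <;> simp [Gm]
  have hm : Gm p q H' S' E α β = (Gm p q H S E α β).updateRow (Sum.inl i)
      (Gm p q H S E α β (Sum.inl i) +
        w • Gm p q H S E (Function.update α i s) β (Sum.inl i)) := by
    ext x y
    rcases x with x | x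
    · by_cases hx : x = i
      · subst hx
        rw [Matrix.updateRow_self]
        rcases y with y | y <;> simp [Gm, hi, hH', hS']
      · rw [Matrix.updateRow_ne (by simpa using hx)]
        have hne : α x ≠ s + 1 := fun h => hx (hα (h.trans hi.symm))
        rcases y with y | y <;> simp [Gm, hH _ _ hne, hS _ _ hne]
    · rw [Matrix.updateRow_ne (by simp)]
      rcases y with y | y <;> simp [Gm]
  rw [hm, Matrix.det_updateRow_add, Matrix.det_updateRow_smul, Matrix.updateRow_eq_self, ← hu]

lemma Gm_row_eq {p q : ℕ} {H : ℕ → ℕ → R} {S : ℕ → Fin q → R} (E : Fin q → ℕ → R)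
    {α : Fin p → ℕ} (β : Fin p → ℕ) (s : ℕ)
    (i j : Fin p) (hi : α i = s + 1) (hj : α j = s) :
    (Gm p q H S E (Function.update α i s) β).det = 0 := by
  have hij : i ≠ j := by
    rintro rfl
    omega
  refine Matrix.det_zero_of_row_eq (i := Sum.inl i) (j := Sum.inl j) (by simpa using hij) ?_
  ext y
  rcases y with y | y <;> simp [Gm, Function.update_of_ne hij.symm, hj]

lemma Gm_row_none {p q : ℕ} {H H' : ℕ → ℕ → R} {S S' : ℕ → Fin q → R} (E : Fin q → ℕ → R)
    {α : Fin p → ℕ} (β : Fin p → ℕ) (s : ℕ)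
    (hH : ∀ a b, a ≠ s + 1 → H' a b = H a b)
    (hS : ∀ a j, a ≠ s + 1 → S' a j = S a j)
    (hi : ∀ i, α i ≠ s + 1) :
    Gm p q H' S' E α β = Gm p q H S E α β := by
  ext x y
  rcases x with x | x <;> rcases y with y | y <;> simp [Gm, hH _ _ (hi _), hS _ _ (hi _)]

lemma last_of_zero {p : ℕ} {α : Fin (p + 1) → ℕ} (hα : StrictAnti α) (i : Fin (p + 1))
    (hi : α i = 0) : i = Fin.last p := by
  by_contra h
  have := hα (lt_of_le_of_ne (Fin.le_last i) h)
  omega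

lemma Gm_zero {p q : ℕ} {H H' : ℕ → ℕ → R} (S : ℕ → Fin q → R) (E : Fin q → ℕ → R)
    {α β : Fin (p + 1) → ℕ} (hα : StrictAnti α) (hβ : StrictAnti β) (w : R)
    (hH : ∀ a b, ¬ (a = 0 ∧ b = 0) → H' a b = H a b) (hH' : H' 0 0 = H 0 0 + w)
    (h1 : α (Fin.last p) = 0) (h2 : β (Fin.last p) = 0) :
    (Gm (p + 1) q H' S E α β).det = (Gm (p + 1) q H S E α β).det +
      w * (Gm p q H S E (fun i => α i.castSucc) (fun i => β i.castSucc)).det := by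
  have hm : Gm (p + 1) q H' S E α β = (Gm (p + 1) q H S E α β).updateRow (Sum.inl (Fin.last p))
      (Gm (p + 1) q H S E α β (Sum.inl (Fin.last p)) +
        w • Pi.single (Sum.inl (Fin.last p)) 1) := by
    ext x y
    rcases x with x | x
    · by_cases hx : x = Fin.last p
      · subst hx
        rw [Matrix.updateRow_self]
        rcases y with y | y
        · by_cases hy : y = Fin.last p
          · subst hy
            simp [Gm, h1, h2, hH']
          · have : β y ≠ 0 := fun h => hy (last_of_zero hβ _ h)
            simp [Gm, h1, hy, hH 0 (β y) (by tauto)]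
        · simp [Gm]
      · rw [Matrix.updateRow_ne (by simpa using hx)]
        have : α x ≠ 0 := fun h => hx (last_of_zero hα _ h)
        rcases y with y | y
        · simp [Gm, hH (α x) (β y) (by tauto)]
        · simp [Gm]
    · rw [Matrix.updateRow_ne (by simp)]
      rcases y with y | y <;> simp [Gm]
  rw [hm, Matrix.det_updateRow_add, Matrix.det_updateRow_smul, Matrix.updateRow_eq_self]
  congr 2
  let e : (Fin p ⊕ Fin q) ⊕ Unit ≃ Fin (p + 1) ⊕ Fin q :=
    { toFun := Sum.elim (Sum.map Fin.castSucc id) (fun _ => Sum.inl (Fin.last p))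
      invFun := Sum.elim (Fin.lastCases (Sum.inr ()) (fun i => Sum.inl (Sum.inl i)))
        (fun j => Sum.inl (Sum.inr j))
      left_inv := by
        rintro ((x | x) | x) <;> simp
      right_inv := by
        rintro (x | x)
        · induction x using Fin.lastCases <;> simp
        · simp }
  rw [← Matrix.det_submatrix_equiv_self e]
  set A := ((Gm (p + 1) q H S E α β).updateRow (Sum.inl (Fin.last p))
    (Pi.single (Sum.inl (Fin.last p)) 1)).submatrix e e with hA
  rw [← Matrix.fromBlocks_toBlocks A]
  have h21 : A.toBlocks₂₁ = 0 := by
    ext x y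
    rcases y with y | y
    · simp [hA, Matrix.toBlocks₂₁, e, Fin.castSucc_ne_last]
    · simp [hA, Matrix.toBlocks₂₁, e]
  have h22 : A.toBlocks₂₂ = 1 := by
    ext x y
    simp [hA, Matrix.toBlocks₂₂, e]
  have h11 : A.toBlocks₁₁ = Gm p q H S E (fun i => α i.castSucc) (fun i => β i.castSucc) := by
    ext x y
    rcases x with x | x <;> rcases y with y | y <;>
      simp [hA, Matrix.toBlocks₁₁, e, Gm, Matrix.updateRow_apply, Fin.castSucc_ne_last]
  rw [h21, Matrix.det_fromBlocks_zero₂₁, h22, h11, Matrix.det_one, mul_one]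

lemma Gm_zero_none {p q : ℕ} {H H' : ℕ → ℕ → R} (S : ℕ → Fin q → R) (E : Fin q → ℕ → R)
    {α β : Fin p → ℕ}
    (hH : ∀ a b, ¬ (a = 0 ∧ b = 0) → H' a b = H a b)
    (h : ∀ i j, ¬ (α i = 0 ∧ β j = 0)) :
    Gm p q H' S E α β = Gm p q H S E α β := by
  ext x y
  rcases x with x | x <;> rcases y with y | y <;> simp [Gm, hH _ _ (h _ _)]

lemma det_swap_blocks (q : ℕ) :
    (Matrix.fromBlocks 0 1 1 0 : Matrix (Fin q ⊕ Fin q) (Fin q ⊕ Fin q) R).det = (-1) ^ q := by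
  have h1 : (Matrix.fromBlocks 0 1 1 0 : Matrix (Fin q ⊕ Fin q) (Fin q ⊕ Fin q) R) *
      Matrix.fromBlocks 1 0 1 1 = Matrix.fromBlocks 1 1 1 0 := by
    rw [Matrix.fromBlocks_multiply]
    simp
  have h2 := congrArg Matrix.det h1
  rw [Matrix.det_mul, Matrix.det_fromBlocks_zero₁₂, Matrix.det_fromBlocks_one₁₁] at h2
  simpa [Matrix.det_neg] using h2

lemma strictAnti_ext {p q : ℕ} {α : Fin p → ℕ} {γ : Fin q → ℕ} (hα : StrictAnti α)
    (hγ : StrictAnti γ) (h1 : ∀ i, ∃ j, α i = γ j) (h2 : ∀ j, ∃ i, α i = γ j) :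
    ∃ h : p = q, α = γ ∘ Fin.cast h := by
  have hr : Set.range α = Set.range γ := by
    ext x
    constructor
    · rintro ⟨i, rfl⟩
      obtain ⟨j, hj⟩ := h1 i
      exact ⟨j, hj.symm⟩
    · rintro ⟨j, rfl⟩
      obtain ⟨i, hi⟩ := h2 j
      exact ⟨i, hi⟩
  have hpq : p = q := by
    have e1 := Set.ncard_range_of_injective hα.injective
    have e2 := Set.ncard_range_of_injective hγ.injective
    rw [hr, e2] at e1
    simpa using e1.symm
  subst hpq
  refine ⟨rfl, ?_⟩
  exact (hα.range_inj hγ).1 hr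

lemma Gm_base {p q : ℕ} {α β : Fin p → ℕ} {γ δ : Fin q → ℕ} (hα : StrictAnti α)
    (hβ : StrictAnti β) (hγ : StrictAnti γ) (hδ : StrictAnti δ)
    (H : ℕ → ℕ → R) (S : ℕ → Fin q → R) (E : Fin q → ℕ → R)
    (hH : ∀ a b, H a b = 0) (hS : ∀ a j, S a j = if a = γ j then 1 else 0)
    (hE : ∀ i b, E i b = if b = δ i then 1 else 0) :
    (-1) ^ q * (Gm p q H S E α β).det = if Fr p α β = Fr q γ δ then 1 else 0 := by
  split_ifs with h
  · obtain ⟨rfl, h2, h3⟩ := Fr_inj h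
    have h2' : α = γ := funext fun i => h2 i i.2 i.2
    have h3' : β = δ := funext fun i => h3 i i.2 i.2
    subst h2' h3'
    have : Gm p p H S E α β = Matrix.fromBlocks 0 1 1 0 := by
      ext x y
      rcases x with x | x <;> rcases y with y | y <;>
        simp [Gm, hH, hS, hE, Matrix.one_apply, hα.injective.eq_iff, hβ.injective.eq_iff, eq_comm]
    rw [this, det_swap_blocks, ← mul_pow]
    simp
  · have h0 : (Gm p q H S E α β).det = 0 := by
      by_contra hdet
      have a1 : ∀ i, ∃ j, α i = γ j := by
        by_contra! hcon
        obtain ⟨i, hi⟩ := hcon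
        apply hdet
        apply Matrix.det_eq_zero_of_row_eq_zero (Sum.inl i)
        rintro (y | y) <;> simp [Gm, hH, hS, hi]
      have a2 : ∀ j, ∃ i, α i = γ j := by
        by_contra! hcon
        obtain ⟨i, hi⟩ := hcon
        apply hdet
        apply Matrix.det_eq_zero_of_column_eq_zero (Sum.inr i)
        rintro (y | y) <;> simp [Gm, hS, hi]
      have b1 : ∀ i, ∃ j, β i = δ j := by
        by_contra! hcon
        obtain ⟨i, hi⟩ := hcon
        apply hdet
        apply Matrix.det_eq_zero_of_column_eq_zero (Sum.inl i)
        rintro (y | y) <;> simp [Gm, hH, hE, hi]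
      have b2 : ∀ j, ∃ i, β i = δ j := by
        by_contra! hcon
        obtain ⟨i, hi⟩ := hcon
        apply hdet
        apply Matrix.det_eq_zero_of_row_eq_zero (Sum.inr i)
        rintro (y | y) <;> simp [Gm, hE, hi]
      obtain ⟨rfl, h1⟩ := strictAnti_ext hα hγ a1 a2
      obtain ⟨_, h2⟩ := strictAnti_ext hβ hδ b1 b2
      apply h
      rw [h1, h2]
      rfl
    rw [h0, mul_zero]

section steps

variable (M : ℕ) (f : ℕ → ℤ → R) (N : ℤ) (m : ℕ)

lemma Fr_pos_none (t : ℤ) {p : ℕ} {α β : Fin p → ℕ} (hα : StrictAnti α) (s : ℕ)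
    (ht : t = (s : ℤ) + 1) (h : (∀ i, α i ≠ s + 1) ∨ ∃ j, α j = s)
    {U : Finset (ℕ × ℕ)} (hU : Low U) :
    Zt M f N m (t + 1) (Fr p α β) U = Zt M f N m t (Fr p α β) U := by
  subst ht
  exact Zt_noCorner M f N m _ hU (noCorner_pos hα h)

lemma Fr_pos (hm : m < M) (t : ℤ) (hN : -N ≤ t) (hN' : t < N) {p : ℕ} {α β : Fin p → ℕ}
    (hα : StrictAnti α) (hβ : StrictAnti β) (s : ℕ)
    (ht : t = (s : ℤ) + 1) (i : Fin p) (hi : α i = s + 1) (hs : ∀ j, α j ≠ s)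
    {U : Finset (ℕ × ℕ)} (hU : Low U) :
    Zt M f N m (t + 1) (Fr p α β) U = Zt M f N m t (Fr p α β) U +
      f (m + 1) t * Zt M f N m t (Fr p (Function.update α i s) β) U := by
  subst ht
  rw [← erase_pos hi]
  exact Zt_corner M f N m hm _ hN hN' (low_Fr hα hβ) hU _ (corner_pos hα hi hs)
    (by simp only [cont]; push_cast; ring)

lemma Fr_neg_none (t : ℤ) {p : ℕ} {α β : Fin p → ℕ} (hβ : StrictAnti β) (s : ℕ)
    (ht : t = -((s : ℤ) + 1)) (h : (∀ i, β i ≠ s + 1) ∨ ∃ j, β j = s)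
    {U : Finset (ℕ × ℕ)} (hU : Low U) :
    Zt M f N m (t + 1) (Fr p α β) U = Zt M f N m t (Fr p α β) U := by
  subst ht
  exact Zt_noCorner M f N m _ hU (noCorner_neg hβ h)

lemma Fr_neg (hm : m < M) (t : ℤ) (hN : -N ≤ t) (hN' : t < N) {p : ℕ} {α β : Fin p → ℕ}
    (hα : StrictAnti α) (hβ : StrictAnti β) (s : ℕ)
    (ht : t = -((s : ℤ) + 1)) (i : Fin p) (hi : β i = s + 1) (hs : ∀ j, β j ≠ s)
    {U : Finset (ℕ × ℕ)} (hU : Low U) :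
    Zt M f N m (t + 1) (Fr p α β) U = Zt M f N m t (Fr p α β) U +
      f (m + 1) t * Zt M f N m t (Fr p α (Function.update β i s)) U := by
  subst ht
  rw [← erase_neg hi]
  exact Zt_corner M f N m hm _ hN hN' (low_Fr hα hβ) hU _ (corner_swap.2 (corner_pos hβ hi hs))
    (by simp only [cont]; push_cast; ring)

lemma Fr_zero_none {p : ℕ} {α β : Fin p → ℕ} (h : ∀ i, ¬ (α i = 0 ∧ β i = 0))
    {U : Finset (ℕ × ℕ)} (hU : Low U) :
    Zt M f N m (0 + 1) (Fr p α β) U = Zt M f N m 0 (Fr p α β) U :=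
  Zt_noCorner M f N m _ hU (noCorner_zero h)

lemma Fr_zero (hm : m < M) (hN : -N ≤ 0) (hN' : 0 < N) {p : ℕ} {α β : Fin (p + 1) → ℕ}
    (hα : StrictAnti α) (hβ : StrictAnti β)
    (h1 : α (Fin.last p) = 0) (h2 : β (Fin.last p) = 0) {U : Finset (ℕ × ℕ)} (hU : Low U) :
    Zt M f N m (0 + 1) (Fr (p + 1) α β) U = Zt M f N m 0 (Fr (p + 1) α β) U +
      f (m + 1) 0 * Zt M f N m 0 (Fr p (fun i => α i.castSucc) (fun i => β i.castSucc)) U := by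
  rw [← erase_zero h1 h2]
  exact Zt_corner M f N m hm _ hN hN' (low_Fr hα hβ) hU _ (corner_zero h1 h2)
    (by simp [cont])

/-- hook shape -/
def Hk (a b : ℕ) : Finset (ℕ × ℕ) := Fr 1 (fun _ => a) (fun _ => b)

lemma strict_one (a : ℕ) : StrictAnti (fun _ : Fin 1 => a) := by
  intro i j h
  exact absurd h (by simp [Subsingleton.elim i j])

lemma low_Hk (a b : ℕ) : Low (Hk a b) := low_Fr (strict_one a) (strict_one b)

lemma low_empty : Low ∅ := fun _ _ _ _ h => absurd h (Finset.notMem_empty _)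

variable {M} {m}

lemma Hk_pos (hm : m < M) (t : ℤ) (hN : -N ≤ t) (hN' : t < N) (s : ℕ)
    (ht : t = (s : ℤ) + 1) (b : ℕ) {U : Finset (ℕ × ℕ)} (hU : Low U) :
    Zt M f N m (t + 1) (Hk (s + 1) b) U = Zt M f N m t (Hk (s + 1) b) U +
      f (m + 1) t * Zt M f N m t (Hk s b) U := by
  have h := Fr_pos M f N m hm t hN hN' (strict_one (s + 1)) (strict_one b) s ht 0 rfl
    (by simp) hU
  have hu : Function.update (fun _ : Fin 1 => s + 1) 0 s = fun _ => s := by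
    funext i
    rw [Subsingleton.elim i 0, Function.update_self]
  rw [hu] at h
  exact h

lemma Hk_pos_none (t : ℤ) (s : ℕ)
    (ht : t = (s : ℤ) + 1) (a b : ℕ) (ha : a ≠ s + 1) {U : Finset (ℕ × ℕ)} (hU : Low U) :
    Zt M f N m (t + 1) (Hk a b) U = Zt M f N m t (Hk a b) U :=
  Fr_pos_none M f N m t (strict_one a) s ht (Or.inl fun _ => ha) hU

lemma Hk_neg (hm : m < M) (t : ℤ) (hN : -N ≤ t) (hN' : t < N) (s : ℕ)
    (ht : t = -((s : ℤ) + 1)) (a : ℕ) {U : Finset (ℕ × ℕ)} (hU : Low U) :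
    Zt M f N m (t + 1) (Hk a (s + 1)) U = Zt M f N m t (Hk a (s + 1)) U +
      f (m + 1) t * Zt M f N m t (Hk a s) U := by
  have h := Fr_neg M f N m hm t hN hN' (strict_one a) (strict_one (s + 1)) s ht 0 rfl
    (by simp) hU
  have hu : Function.update (fun _ : Fin 1 => s + 1) 0 s = fun _ => s := by
    funext i
    rw [Subsingleton.elim i 0, Function.update_self]
  rw [hu] at h
  exact h

lemma Hk_neg_none (t : ℤ) (s : ℕ)
    (ht : t = -((s : ℤ) + 1)) (a b : ℕ) (hb : b ≠ s + 1) {U : Finset (ℕ × ℕ)} (hU : Low U) :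
    Zt M f N m (t + 1) (Hk a b) U = Zt M f N m t (Hk a b) U :=
  Fr_neg_none M f N m t (strict_one b) s ht (Or.inl fun _ => hb) hU

lemma Hk_zero (hm : m < M) (hN : -N ≤ 0) (hN' : 0 < N) {U : Finset (ℕ × ℕ)} (hU : Low U) :
    Zt M f N m (0 + 1) (Hk 0 0) U = Zt M f N m 0 (Hk 0 0) U +
      f (m + 1) 0 * Zt M f N m 0 ∅ U := by
  have h := Fr_zero M f N m hm hN hN' (strict_one 0) (strict_one 0) rfl rfl hU
  have he : Fr 0 (fun i : Fin 0 => (fun _ : Fin 1 => 0) i.castSucc)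
    (fun i : Fin 0 => (fun _ : Fin 1 => 0) i.castSucc) = ∅ := by
    simp [Fr]
  rw [he] at h
  exact h

lemma Hk_zero_none (a b : ℕ) (h : ¬ (a = 0 ∧ b = 0)) {U : Finset (ℕ × ℕ)} (hU : Low U) :
    Zt M f N m (0 + 1) (Hk a b) U = Zt M f N m 0 (Hk a b) U :=
  Fr_zero_none M f N m (fun _ => h) hU

lemma Zt_empty_empty (t : ℤ) : Zt M f N m t ∅ ∅ = 1 := by
  classical
  unfold Zt Zs
  simp only [Finset.Subset.refl, if_true]
  have : IsEmpty ↥((∅ : Finset (ℕ × ℕ)) \ ∅) := ⟨fun x => by simpa using x.2⟩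
  rw [Finset.filter_true_of_mem]
  · simp
  · intro T _
    exact ⟨⟨fun c => isEmptyElim c, fun c => isEmptyElim c⟩, fun c => isEmptyElim c⟩

lemma Hk_nonempty (a b : ℕ) : (0, 0) ∈ Hk a b := by
  unfold Hk
  rw [mem_Fr_diag]
  omega

lemma Zt_empty_Hk (t : ℤ) (a b : ℕ) : Zt M f N m t ∅ (Hk a b) = 0 := by
  unfold Zt
  rw [if_neg]
  intro h
  exact absurd (h (Hk_nonempty a b)) (Finset.notMem_empty _)

variable (M m)

/-- the Giambelli matrix at step `(m,t)` -/
noncomputable def GG {q : ℕ} (γ δ : Fin q → ℕ) (t : ℤ) (p : ℕ) (α β : Fin p → ℕ) :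
    Matrix (Fin p ⊕ Fin q) (Fin p ⊕ Fin q) R :=
  Gm p q (fun a b => Zt M f N m t (Hk a b) ∅)
    (fun a j => Zt M f N m t (Hk a 0) (Hk (γ j) 0))
    (fun i b => Zt M f N m t (Hk 0 b) (Hk 0 (δ i))) α β

/-- Giambelli at step `(m,t)` -/
def Claim {q : ℕ} (γ δ : Fin q → ℕ) (t : ℤ) : Prop :=
  ∀ (p : ℕ) (α β : Fin p → ℕ), StrictAnti α → StrictAnti β →
    Zt M f N m t (Fr p α β) (Fr q γ δ) = (-1) ^ q * (GG M f N m γ δ t p α β).det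

variable {M m}

lemma claim_step (hm : m < M) {q : ℕ} {γ δ : Fin q → ℕ} (hγ : StrictAnti γ) (hδ : StrictAnti δ)
    (t : ℤ) (hN : -N ≤ t) (hN' : t < N) (h : Claim M f N m γ δ t) :
    Claim M f N m γ δ (t + 1) := by
  have hU := low_Fr hγ hδ
  intro p α β hα hβ
  rcases lt_trichotomy t 0 with h0 | h0 | h0
  · obtain ⟨s, ht⟩ : ∃ s : ℕ, t = -((s : ℤ) + 1) := ⟨(-t - 1).toNat, by omega⟩
    have hS : (fun (j : Fin q) a => Zt M f N m (t + 1) (Hk a 0) (Hk (γ j) 0)) =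
        (fun j a => Zt M f N m t (Hk a 0) (Hk (γ j) 0)) := by
      funext j a
      exact Hk_neg_none f N t s ht _ _ (by omega) (low_Hk _ _)
    have e1 : ∀ p (α β : Fin p → ℕ), (GG M f N m γ δ t p α β).det = _ :=
      fun p α β => Gm_transpose p q _ _ _ α β
    have e2 : (GG M f N m γ δ (t + 1) p α β).det = _ := Gm_transpose p q _ _ _ α β
    rw [hS] at e2
    by_cases hi : ∃ i, β i = s + 1
    · obtain ⟨i, hi⟩ := hi
      rw [Gm_row (H := fun b a => Zt M f N m t (Hk a b) ∅)
        (S := fun b i => Zt M f N m t (Hk 0 b) (Hk 0 (δ i))) _ _ hβ.injective s (f (m + 1) t)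
        (fun a b ha => Hk_neg_none f N t s ht _ _ ha low_empty)
        (fun b => Hk_neg f N hm t hN hN' s ht _ low_empty)
        (fun a j ha => Hk_neg_none f N t s ht _ _ ha (low_Hk _ _))
        (fun j => Hk_neg f N hm t hN hN' s ht _ (low_Hk _ _)) i hi] at e2
      rw [e2, mul_add, ← e1, ← h p α β hα hβ]
      by_cases hs : ∃ j, β j = s
      · obtain ⟨j, hj⟩ := hs
        rw [Gm_row_eq _ _ s i j hi hj, mul_zero, mul_zero, add_zero]
        exact Fr_neg_none M f N m t hβ s ht (Or.inr ⟨j, hj⟩) hU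
      · push Not at hs
        rw [← e1 p α (Function.update β i s), mul_left_comm,
          ← h p α _ hα (strict_update hβ hi hs)]
        exact Fr_neg M f N m hm t hN hN' hα hβ s ht i hi hs hU
    · push Not at hi
      rw [Gm_row_none (H := fun b a => Zt M f N m t (Hk a b) ∅)
        (S := fun b i => Zt M f N m t (Hk 0 b) (Hk 0 (δ i))) _ _ s
        (fun a b ha => Hk_neg_none f N t s ht _ _ ha low_empty)
        (fun a j ha => Hk_neg_none f N t s ht _ _ ha (low_Hk _ _)) hi] at e2
      rw [e2, ← e1, ← h p α β hα hβ]
      exact Fr_neg_none M f N m t hβ s ht (Or.inl hi) hU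
  · subst h0
    have hS : (fun a (j : Fin q) => Zt M f N m (0 + 1) (Hk a 0) (Hk (γ j) 0)) =
        (fun a j => Zt M f N m 0 (Hk a 0) (Hk (γ j) 0)) := by
      funext a j
      by_cases ha : a = 0
      · subst ha
        rw [Hk_zero f N hm hN hN' (low_Hk _ _), Zt_empty_Hk, mul_zero, add_zero]
      · exact Hk_zero_none f N _ _ (by tauto) (low_Hk _ _)
    have hE : (fun (i : Fin q) b => Zt M f N m (0 + 1) (Hk 0 b) (Hk 0 (δ i))) =
        (fun i b => Zt M f N m 0 (Hk 0 b) (Hk 0 (δ i))) := by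
      funext a j
      by_cases ha : j = 0
      · subst ha
        rw [Hk_zero f N hm hN hN' (low_Hk _ _), Zt_empty_Hk, mul_zero, add_zero]
      · exact Hk_zero_none f N _ _ (by tauto) (low_Hk _ _)
    unfold GG
    rw [hS, hE]
    by_cases hc : ∃ i, α i = 0 ∧ β i = 0
    · obtain ⟨i, h1, h2⟩ := hc
      obtain ⟨p, rfl⟩ : ∃ p', p = p' + 1 := ⟨p - 1, by have := i.2; omega⟩
      have hi := last_of_zero hα i h1
      subst hi
      rw [Gm_zero (H := fun a b => Zt M f N m 0 (Hk a b) ∅) _ _ hα hβ (f (m + 1) 0)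
        (fun a b hab => Hk_zero_none f N _ _ hab low_empty)
        (by rw [Hk_zero f N hm hN hN' low_empty, Zt_empty_empty, mul_one]) h1 h2]
      have c1 := h _ _ _ hα hβ
      have c2 := h p (fun i => α i.castSucc) (fun i => β i.castSucc)
        (fun i j hij => hα (by simpa using hij)) (fun i j hij => hβ (by simpa using hij))
      unfold GG at c1 c2
      rw [mul_add, ← c1, mul_left_comm, ← c2]
      exact Fr_zero M f N m hm hN hN' hα hβ h1 h2 hU
    · push Not at hc
      have hc' : ∀ i j, ¬ (α i = 0 ∧ β j = 0) := by
        rintro i j ⟨h1, h2⟩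
        obtain ⟨p, rfl⟩ : ∃ p', p = p' + 1 := ⟨p - 1, by have := i.2; omega⟩
        have e1 := last_of_zero hα i h1
        have e2 := last_of_zero hβ j h2
        subst e1 e2
        exact hc _ h1 h2
      rw [Gm_zero_none (H := fun a b => Zt M f N m 0 (Hk a b) ∅) _ _
        (fun a b hab => Hk_zero_none f N _ _ hab low_empty) hc']
      have c1 := h _ _ _ hα hβ
      unfold GG at c1
      rw [← c1]
      exact Fr_zero_none M f N m (fun i => hc' i i) hU
  · obtain ⟨s, ht⟩ : ∃ s : ℕ, t = (s : ℤ) + 1 := ⟨(t - 1).toNat, by omega⟩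
    have hE : (fun (i : Fin q) b => Zt M f N m (t + 1) (Hk 0 b) (Hk 0 (δ i))) =
        (fun i b => Zt M f N m t (Hk 0 b) (Hk 0 (δ i))) := by
      funext a j
      exact Hk_pos_none f N t s ht _ _ (by omega) (low_Hk _ _)
    have e2 : (GG M f N m γ δ (t + 1) p α β).det = (GG M f N m γ δ (t + 1) p α β).det := rfl
    conv_rhs at e2 => unfold GG
    rw [hE] at e2
    by_cases hi : ∃ i, α i = s + 1
    · obtain ⟨i, hi⟩ := hi
      rw [Gm_row (H := fun a b => Zt M f N m t (Hk a b) ∅)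
        (S := fun a j => Zt M f N m t (Hk a 0) (Hk (γ j) 0)) _ _ hα.injective s (f (m + 1) t)
        (fun a b ha => Hk_pos_none f N t s ht _ _ ha low_empty)
        (fun b => Hk_pos f N hm t hN hN' s ht _ low_empty)
        (fun a j ha => Hk_pos_none f N t s ht _ _ ha (low_Hk _ _))
        (fun j => Hk_pos f N hm t hN hN' s ht _ (low_Hk _ _)) i hi] at e2
      have c1 := h p α β hα hβ
      unfold GG at c1
      rw [e2, mul_add, ← c1]
      by_cases hs : ∃ j, α j = s
      · obtain ⟨j, hj⟩ := hs
        rw [Gm_row_eq _ _ s i j hi hj, mul_zero, mul_zero, add_zero]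
        exact Fr_pos_none M f N m t hα s ht (Or.inr ⟨j, hj⟩) hU
      · push Not at hs
        have c2 := h p _ β (strict_update hα hi hs) hβ
        unfold GG at c2
        rw [mul_left_comm, ← c2]
        exact Fr_pos M f N m hm t hN hN' hα hβ s ht i hi hs hU
    · push Not at hi
      rw [Gm_row_none (H := fun a b => Zt M f N m t (Hk a b) ∅)
        (S := fun a j => Zt M f N m t (Hk a 0) (Hk (γ j) 0)) _ _ s
        (fun a b ha => Hk_pos_none f N t s ht _ _ ha low_empty)
        (fun a j ha => Hk_pos_none f N t s ht _ _ ha (low_Hk _ _)) hi] at e2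
      have c1 := h p α β hα hβ
      unfold GG at c1
      rw [e2, ← c1]
      exact Fr_pos_none M f N m t hα s ht (Or.inl hi) hU

lemma claim_next {q : ℕ} {γ δ : Fin q → ℕ}
    (h : Claim M f N m γ δ N) : Claim M f N (m + 1) γ δ (-N) := by
  intro p α β hα hβ
  unfold GG
  simp only [Zt_next]
  exact h p α β hα hβ

lemma Hk_inj {a b c d : ℕ} : Hk a b = Hk c d ↔ a = c ∧ b = d := by
  constructor
  · intro h
    obtain ⟨_, h1, h2⟩ := Fr_inj h
    exact ⟨h1 0 (by omega) (by omega), h2 0 (by omega) (by omega)⟩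
  · rintro ⟨rfl, rfl⟩
    rfl

lemma claim_base {q : ℕ} {γ δ : Fin q → ℕ} (hγ : StrictAnti γ) (hδ : StrictAnti δ) :
    Claim M f N 0 γ δ (-N) := by
  intro p α β hα hβ
  rw [Zt_zero]
  unfold GG
  rw [Gm_base hα hβ hγ hδ]
  · intro a b
    rw [Zt_zero, if_neg]
    intro h
    exact absurd (h ▸ Hk_nonempty a b) (Finset.notMem_empty _)
  · intro a j
    simp only [Zt_zero, Hk_inj, and_true]
  · intro a j
    simp only [Zt_zero, Hk_inj, true_and]

lemma claim_all (hN : 0 ≤ N) {q : ℕ} {γ δ : Fin q → ℕ} (hγ : StrictAnti γ) (hδ : StrictAnti δ) :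
    ∀ m ≤ M, Claim M f N m γ δ (-N) := by
  intro m
  induction m with
  | zero => intro _; exact claim_base f N hγ hδ
  | succ m ih =>
    intro hm
    apply claim_next
    have key : ∀ k : ℕ, (k : ℤ) ≤ 2 * N → Claim M f N m γ δ (-N + k) := by
      intro k
      induction k with
      | zero => intro _; simpa using ih (by omega)
      | succ k ihk =>
        intro hk
        push_cast at hk ⊢
        rw [← add_assoc]
        exact claim_step f N (by omega) hγ hδ _ (by omega) (by omega) (ihk (by omega))
    have := key (2 * N).toNat (by omega)
    have e : -N + ((2 * N).toNat : ℤ) = N := by omega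
    rwa [e] at this

end steps

lemma Zs_full (M : ℕ) (f : ℕ → ℤ → R) (N : ℤ) (t : ℤ) (S : Finset (ℕ × ℕ))
    (hS : ∀ c ∈ S, -N ≤ cont c ∧ cont c < N) [DecidablePred fun T : ↥S → Fin M => SS T] :
    Zs M f N M t S = ∑ T ∈ Finset.univ.filter (fun T : ↥S → Fin M => SS T),
      ∏ c : ↥S, f ((T c : ℕ) + 1) (cont c.val) := by
  classical
  unfold Zs
  apply Finset.sum_congr _ (fun _ _ => rfl)
  ext T
  simp only [Finset.mem_filter, Finset.mem_univ, true_and]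
  refine ⟨fun h => h.1, fun h => ⟨h, fun c => ?_⟩⟩
  exact ⟨(hS _ c.2).1, (hS _ c.2).2, Or.inl (T c).2⟩

lemma zetaT_eq (M B : ℕ) (lam mu : ℕ → ℕ) (a : ℤ → ℂ) (N t : ℤ) (S : Finset (ℕ × ℕ))
    (h : cellsD B lam mu = S) (hS : ∀ c ∈ S, -N ≤ cont c ∧ cont c < N) :
    zetaT M B lam mu a = Zs M (fun k t => (k : ℂ) ^ (-(a t))) N M t S := by
  classical
  subst h
  rw [Zs_full M _ N t _ hS]
  unfold zetaT zetaTF tabSum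
  apply Finset.sum_congr
  · ext T
    simp only [Finset.mem_filter, Finset.mem_univ, true_and]
    rfl
  · intro T _
    rfl

lemma Zs_line (M d : ℕ) (f : ℕ → ℤ → R) (N t : ℤ) (S : Finset (ℕ × ℕ))
    (hS : ∀ c ∈ S, -N ≤ cont c ∧ cont c < N) (e : Fin d ≃ ↥S)
    (P : (Fin d → Fin M) → Prop) [DecidablePred P]
    (hP : ∀ T : ↥S → Fin M, SS T ↔ P (T ∘ e)) :
    ∑ T ∈ Finset.univ.filter P, ∏ k : Fin d, f ((T k : ℕ) + 1) (cont (e k).val) =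
      Zs M f N M t S := by
  classical
  rw [Zs_full M _ N t _ hS]
  symm
  refine Finset.sum_equiv (e.symm.arrowCongr (Equiv.refl _)) ?_ ?_
  · intro T
    simp only [Finset.mem_filter, Finset.mem_univ, true_and]
    rw [hP T]
    rfl
  · intro T _
    rw [← Equiv.prod_comp e]
    rfl

lemma mem_Hk {a b x y : ℕ} : (x, y) ∈ Hk a b ↔ (x = 0 ∧ y ≤ a) ∨ (y = 0 ∧ x ≤ b) := by
  unfold Hk
  rw [mem_Fr]
  simp only
  constructor
  · rintro (⟨h1, h2, h3⟩ | ⟨h1, h2, h3⟩)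
    · left; omega
    · right; omega
  · rintro (⟨h1, h2⟩ | ⟨h1, h2⟩)
    · exact Or.inl ⟨by omega, by omega, by omega⟩
    · exact Or.inr ⟨by omega, by omega, by omega⟩

lemma mem_rowS {a g x y : ℕ} : (x, y) ∈ Hk a 0 \ Hk g 0 ↔ x = 0 ∧ g < y ∧ y ≤ a := by
  rw [Finset.mem_sdiff, mem_Hk, mem_Hk]
  omega

lemma mem_colS {b g x y : ℕ} : (x, y) ∈ Hk 0 b \ Hk 0 g ↔ y = 0 ∧ g < x ∧ x ≤ b := by
  rw [Finset.mem_sdiff, mem_Hk, mem_Hk]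
  omega

/-- cells of a row -/
def rowE (a g : ℕ) : Fin (a - g) ≃ ↥(Hk a 0 \ Hk g 0) where
  toFun k := ⟨(0, g + 1 + k), mem_rowS.2 ⟨rfl, by omega, by omega⟩⟩
  invFun c := ⟨c.val.2 - (g + 1), by
    have := mem_rowS.1 (show (c.val.1, c.val.2) ∈ _ from c.2)
    omega⟩
  left_inv k := by
    apply Fin.ext
    simp
  right_inv c := by
    have := mem_rowS.1 (show (c.val.1, c.val.2) ∈ _ from c.2)
    apply Subtype.ext
    apply Prod.ext
    · simp only; omega
    · simp only; omega

/-- cells of a column -/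
def colE (a g : ℕ) : Fin (a - g) ≃ ↥(Hk 0 a \ Hk 0 g) where
  toFun k := ⟨(g + 1 + k, 0), mem_colS.2 ⟨rfl, by omega, by omega⟩⟩
  invFun c := ⟨c.val.1 - (g + 1), by
    have := mem_colS.1 (show (c.val.1, c.val.2) ∈ _ from c.2)
    omega⟩
  left_inv k := by
    apply Fin.ext
    simp
  right_inv c := by
    have := mem_colS.1 (show (c.val.1, c.val.2) ∈ _ from c.2)
    apply Subtype.ext
    apply Prod.ext
    · simp only; omega
    · simp only; omega

lemma star_eq (M a g : ℕ) (s : ℤ → ℂ) (N t : ℤ) (hN : (a : ℤ) < N) :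
    (if g ≤ a then zetaStarT M (a - g) (fun kk => s ((g : ℤ) + 1 + (kk : ℤ))) else 0) =
      Zt M (fun k t => (k : ℂ) ^ (-(s t))) N M t (Hk a 0) (Hk g 0) := by
  classical
  unfold Zt
  have hsub : Hk g 0 ⊆ Hk a 0 ↔ g ≤ a := by
    constructor
    · intro h
      have := mem_Hk.1 (h (mem_Hk.2 (Or.inl ⟨rfl, le_rfl⟩) : (0, g) ∈ Hk g 0))
      omega
    · rintro h ⟨x, y⟩ hx
      rw [mem_Hk] at hx ⊢
      omega
  by_cases hga : g ≤ a
  · rw [if_pos hga, if_pos (hsub.2 hga)]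
    rw [← Zs_line M (a - g) _ N t _ _ (rowE a g) (fun T => ∀ i j, i ≤ j → T i ≤ T j)]
    · unfold zetaStarT
      apply Finset.sum_congr
      · ext T
        simp
      · intro T _
        apply Finset.prod_congr rfl
        intro k _
        simp [rowE, cont]
    · intro T
      constructor
      · intro h i j hij
        exact h.1 _ _ rfl (by simpa [rowE] using hij)
      · intro h
        have key : ∀ c, T c = (T ∘ rowE a g) ((rowE a g).symm c) := by simp
        refine ⟨fun c c' h1 h2 => ?_, fun c c' h1 h2 => ?_⟩
        · rw [key c, key c']
          apply h
          simp only [rowE, Equiv.coe_fn_symm_mk, Fin.le_def]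
          omega
        · have e1 := mem_rowS.1 (show (c.val.1, c.val.2) ∈ _ from c.2)
          have e2 := mem_rowS.1 (show (c'.val.1, c'.val.2) ∈ _ from c'.2)
          omega
    · rintro ⟨x, y⟩ hc
      rw [mem_rowS] at hc
      simp only [cont]
      omega
  · rw [if_neg hga, if_neg (fun h => hga (hsub.1 h))]

lemma mzv_eq (M a g : ℕ) (s : ℤ → ℂ) (N t : ℤ) (hN : (a : ℤ) < N) :
    (if g ≤ a then zetaMT M (a - g) (fun kk => s (-(g : ℤ) - 1 - (kk : ℤ))) else 0) =
      Zt M (fun k t => (k : ℂ) ^ (-(s t))) N M t (Hk 0 a) (Hk 0 g) := by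
  classical
  unfold Zt
  have hsub : Hk 0 g ⊆ Hk 0 a ↔ g ≤ a := by
    constructor
    · intro h
      have := mem_Hk.1 (h (mem_Hk.2 (Or.inr ⟨rfl, le_rfl⟩) : (g, 0) ∈ Hk 0 g))
      omega
    · rintro h ⟨x, y⟩ hx
      rw [mem_Hk] at hx ⊢
      omega
  by_cases hga : g ≤ a
  · rw [if_pos hga, if_pos (hsub.2 hga)]
    rw [← Zs_line M (a - g) _ N t _ _ (colE a g) (fun T => ∀ i j, i < j → T i < T j)]
    · unfold zetaMT
      apply Finset.sum_congr
      · ext T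
        simp
      · intro T _
        apply Finset.prod_congr rfl
        intro k _
        have : cont (colE a g k).val = -(g : ℤ) - 1 - ((k : ℕ) : ℤ) := by
          simp only [colE, cont, Equiv.coe_fn_mk]
          push_cast
          ring
        rw [this]
    · intro T
      constructor
      · intro h i j hij
        exact h.2 _ _ (by simpa [colE] using hij) rfl
      · intro h
        have key : ∀ c, T c = (T ∘ colE a g) ((colE a g).symm c) := by simp
        refine ⟨fun c c' h1 h2 => ?_, fun c c' h1 h2 => ?_⟩
        · have e1 := mem_colS.1 (show (c.val.1, c.val.2) ∈ _ from c.2)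
          have e2 := mem_colS.1 (show (c'.val.1, c'.val.2) ∈ _ from c'.2)
          have : c = c' := Subtype.ext (Prod.ext h1 (by omega))
          rw [this]
        · rw [key c, key c']
          apply h
          have e1 := mem_colS.1 (show (c.val.1, c.val.2) ∈ _ from c.2)
          simp only [colE, Equiv.coe_fn_symm_mk, Fin.lt_def]
          omega
    · rintro ⟨x, y⟩ hc
      rw [mem_colS] at hc
      simp only [cont]
      omega
  · rw [if_neg hga, if_neg (fun h => hga (hsub.1 h))]

lemma hook_eq (M B a b : ℕ) (s : ℤ → ℂ) (N t : ℤ) (hN : (a : ℤ) < N) (hN' : (b : ℤ) ≤ N)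
    (hB : b < B) : zetaT M B (hookP a b) (fun _ => 0) s =
      Zt M (fun k t => (k : ℂ) ^ (-(s t))) N M t (Hk a b) ∅ := by
  unfold Zt
  rw [if_pos (Finset.empty_subset _)]
  apply zetaT_eq
  · ext ⟨x, y⟩
    simp only [cellsD, Finset.mem_filter, Finset.mem_product, Finset.mem_range, hookP,
      Finset.sdiff_empty, mem_Hk, if_true]
    by_cases hx : x = 0
    · subst hx
      simp only [if_true, true_and, zero_le]
      omega
    · simp only [hx, if_false, false_and, false_or, zero_le, true_and]
      split_ifs <;> omega
  · rintro ⟨x, y⟩ hc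
    rw [Finset.sdiff_empty, mem_Hk] at hc
    simp only [cont]
    omega

lemma lt_conjF {lam : ℕ → ℕ} {B : ℕ} (hlam : Antitone lam) (hlen : ∀ i, B ≤ i → lam i = 0)
    (x y : ℕ) : x < conjF lam B y ↔ y < lam x := by
  unfold conjF
  constructor
  · intro h
    by_contra hy
    have : (Finset.range B).filter (fun j => y + 1 ≤ lam j) ⊆ Finset.range x := by
      intro j hj
      rw [Finset.mem_filter] at hj
      rw [Finset.mem_range]
      by_contra hxj
      have := hlam (show x ≤ j by omega)
      omega
    have := Finset.card_le_card this
    rw [Finset.card_range] at this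
    omega
  · intro h
    have : Finset.range (x + 1) ⊆ (Finset.range B).filter (fun j => y + 1 ≤ lam j) := by
      intro j hj
      rw [Finset.mem_range] at hj
      rw [Finset.mem_filter, Finset.mem_range]
      have := hlam (show j ≤ x by omega)
      refine ⟨?_, by omega⟩
      by_contra hB
      have := hlen j (by omega)
      omega
    have := Finset.card_le_card this
    rw [Finset.card_range] at this
    omega

lemma mem_part {lam : ℕ → ℕ} {B p : ℕ} {α β : Fin p → ℕ} (hlam : Antitone lam)
    (hlen : ∀ i, B ≤ i → lam i = 0)
    (hα : ∀ i : Fin p, lam (i : ℕ) = α i + (i : ℕ) + 1)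
    (hβ : ∀ i : Fin p, conjF lam B (i : ℕ) = β i + (i : ℕ) + 1)
    (hp : lam p ≤ p) (x y : ℕ) : (x, y) ∈ Fr p α β ↔ y < lam x := by
  rcases le_or_gt x y with h | h
  · have : (x, y) ∈ Fr p α β ↔ ∃ h : x < p, y ≤ α ⟨x, h⟩ + x := by
      rcases eq_or_lt_of_le h with h | h
      · subst h
        rw [mem_Fr_diag]
        exact ⟨fun h => ⟨h, by omega⟩, fun ⟨h, _⟩ => h⟩
      · exact mem_Fr_le h
    rw [this]
    constructor
    · rintro ⟨h1, h2⟩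
      have := hα ⟨x, h1⟩
      simp only at this
      omega
    · intro h1
      have hx : x < p := by
        by_contra hx
        have := hlam (show p ≤ x by omega)
        omega
      have := hα ⟨x, hx⟩
      simp only at this
      exact ⟨hx, by omega⟩
  · rw [mem_Fr_ge h, ← lt_conjF hlam hlen]
    constructor
    · rintro ⟨h1, h2⟩
      have := hβ ⟨y, h1⟩
      simp only at this
      omega
    · intro h1
      have hy : y < p := by
        by_contra hy
        have := hlam (show p ≤ x by omega)
        have := (lt_conjF hlam hlen x y).1 h1
        omega
      have := hβ ⟨y, hy⟩
      simp only at this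
      exact ⟨hy, by omega⟩

lemma strict_of {lam : ℕ → ℕ} {p : ℕ} {α : Fin p → ℕ} (hlam : Antitone lam)
    (hα : ∀ i : Fin p, lam (i : ℕ) = α i + (i : ℕ) + 1) : StrictAnti α := by
  intro i j hij
  have h1 := hα i
  have h2 := hα j
  have hij' : (i : ℕ) < j := hij
  have := hlam hij'.le
  omega

lemma conjF_anti (lam : ℕ → ℕ) (B : ℕ) : Antitone (conjF lam B) := by
  intro i j hij
  unfold conjF
  apply Finset.card_le_card
  intro x hx
  rw [Finset.mem_filter] at hx ⊢
  exact ⟨hx.1, by omega⟩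

lemma conjF_le (lam : ℕ → ℕ) (B i : ℕ) : conjF lam B i ≤ B := by
  unfold conjF
  refine (Finset.card_filter_le _ _).trans ?_
  simp

end GB

/-- Giambelli formula for truncated diagonally constant Schur multiple zeta values. -/
theorem giambelli_truncated_schur_zeta (M : ℕ) (hM : 0 < M) (a : ℤ → ℂ)
    (B : ℕ) (lam mu : ℕ → ℕ)
    (hlam : ∀ i, lam (i + 1) ≤ lam i) (hmu : ∀ i, mu (i + 1) ≤ mu i)
    (hsub : ∀ i, mu i ≤ lam i)
    (hlen : ∀ i, B ≤ i → lam i = 0)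
    (p q : ℕ) (α β : Fin p → ℕ) (γ δ : Fin q → ℕ)
    (hα : ∀ i : Fin p, lam (i : ℕ) = α i + (i : ℕ) + 1)
    (hβ : ∀ i : Fin p, conjF lam B (i : ℕ) = β i + (i : ℕ) + 1)
    (hp : lam p ≤ p)
    (hγ : ∀ i : Fin q, mu (i : ℕ) = γ i + (i : ℕ) + 1)
    (hδ : ∀ i : Fin q, conjF mu B (i : ℕ) = δ i + (i : ℕ) + 1)
    (hq : mu q ≤ q) :
    zetaT M B lam mu a =
      (-1 : ℂ) ^ q *
        Matrix.det
          (Matrix.fromBlocks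
            (Matrix.of fun i j : Fin p => zetaT M B (hookP (α i) (β j)) (fun _ => 0) a)
            (Matrix.of fun (i : Fin p) (j : Fin q) =>
              if γ j ≤ α i then
                zetaStarT M (α i - γ j) (fun kk => a ((γ j : ℤ) + 1 + (kk : ℤ)))
              else 0)
            (Matrix.of fun (i : Fin q) (j : Fin p) =>
              if δ i ≤ β j then
                zetaMT M (β j - δ i) (fun kk => a (-(δ i : ℤ) - 1 - (kk : ℤ)))
              else 0)
            (0 : Matrix (Fin q) (Fin q) ℂ)) := by
  have hl : Antitone lam := antitone_nat_of_succ_le hlam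
  have hm : Antitone mu := antitone_nat_of_succ_le hmu
  have hlen' : ∀ i, B ≤ i → mu i = 0 := fun i hi => by
    have := hsub i
    have := hlen i hi
    omega
  have sα := GB.strict_of hl hα
  have sβ := GB.strict_of (GB.conjF_anti lam B) hβ
  have sγ := GB.strict_of hm hγ
  have sδ := GB.strict_of (GB.conjF_anti mu B) hδ
  have mL := GB.mem_part hl hlen hα hβ hp
  have mU := GB.mem_part hm hlen' hγ hδ hq
  have bα : ∀ i, α i < lam 0 := fun i => by
    have h1 := hα i
    have h2 := hl (Nat.zero_le (i : ℕ))
    omega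
  have bβ : ∀ i, β i < B := fun i => by
    have h1 := hβ i
    have h2 := GB.conjF_le lam B i
    omega
  have hUL : GB.Fr q γ δ ⊆ GB.Fr p α β := by
    rintro ⟨x, y⟩ h
    rw [mU] at h
    rw [mL]
    exact lt_of_lt_of_le h (hsub x)
  obtain ⟨N, hN⟩ : ∃ N : ℤ, N = B + lam 0 := ⟨_, rfl⟩
  have key := GB.claim_all (M := M) (fun k t => (k : ℂ) ^ (-(a t))) N (by omega) sγ sδ M le_rfl
    p α β sα sβ
  unfold GB.Zt at key
  rw [if_pos hUL] at key
  rw [GB.zetaT_eq M B lam mu a N (-N) (GB.Fr p α β \ GB.Fr q γ δ), key]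
  · congr 2
    unfold GB.GG GB.Gm
    congr 1
    · ext i j
      have h1 := bα i
      have h2 := bβ j
      exact (GB.hook_eq M B (α i) (β j) a N (-N) (by omega) (by omega) h2).symm
    · ext i j
      have h1 := bα i
      exact (GB.star_eq M (α i) (γ j) a N (-N) (by omega)).symm
    · ext i j
      have h1 := bβ j
      exact (GB.mzv_eq M (β j) (δ i) a N (-N) (by omega)).symm
  · ext ⟨x, y⟩
    rw [Finset.mem_sdiff, mL, mU]
    simp only [cellsD, Finset.mem_filter, Finset.mem_product, Finset.mem_range]
    have h1 := hl (Nat.zero_le x)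
    have h2 := hlen x
    omega
  · rintro ⟨x, y⟩ hc
    rw [Finset.mem_sdiff, mL, mU] at hc
    have h1 := hl (Nat.zero_le x)
    have h2 := hlen x
    simp only [GB.cont]
    omega
end

section
/- Desnanot–Jacobi relation for truncated Schur multiple zeta values, row version (Corollary 5.3(1)): Let M be a positive integer, a : ℤ → ℂ, k ≥ 1, and let λ = (λ_1 ≥ ⋯ ≥ λ_{k+1} ≥ 0), μ = (μ_1 ≥ ⋯ ≥ μ_{k+1} ≥ 0) be partitions with μ_i ≤ λ_i for all i. Then ζ^M_{(λ_1,…,λ_{k+1})/(μ_1,…,μ_{k+1})}(a) · ζ^M_{(λ_2,…,λ_k)/(μ_2,…,μ_k)}(τ^{−1}a) = ζ^M_{(λ_1,…,λ_k)/(μ_1,…,μ_k)}(a) · ζ^M_{(λ_2,…,λ_{k+1})/(μ_2,…,μ_{k+1})}(τ^{−1}a) − ζ^M_{(λ_2−1,…,λ_{k+1}−1)/(μ_1,…,μ_k)}(a) · ζ^M_{(λ_1+1,…,λ_k+1)/(μ_2,…,μ_{k+1})}(τ^{−1}a), with the convention that ζ^M_{ν/κ}(·) := 0 whenever ν/κ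 is not a skew partition. -/
open Matrix BigOperators Finset Filter

theorem det_two_col {N : ℕ} {R : Type*} [CommRing R] (i j : Fin N) (hij : i ≠ j) (u v : Fin N → R) :
    (Matrix.updateCol (Matrix.updateCol (1 : Matrix (Fin N) (Fin N) R) i u) j v).det
      = u i * v j - u j * v i := by
  have h : (Matrix.updateCol (Matrix.updateCol (1 : Matrix (Fin N) (Fin N) R) i u) j v)
      = 1 + (Matrix.of fun (p : Fin N) (b : Fin 2) =>
          if b = 0 then u p - (1 : Matrix (Fin N) (Fin N) R) p i
          else v p - (1 : Matrix (Fin N) (Fin N) R) p j) *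
        (Matrix.of fun (b : Fin 2) (q : Fin N) =>
          if b = 0 then (1 : Matrix (Fin N) (Fin N) R) i q
          else (1 : Matrix (Fin N) (Fin N) R) j q) := by
    ext p q
    simp only [Matrix.updateCol_apply, Matrix.add_apply, Matrix.mul_apply, Fin.sum_univ_two,
      Matrix.of_apply]
    by_cases hj : q = j
    · subst hj
      simp [Matrix.one_apply_ne hij]
    · by_cases hi : q = i
      · subst hi
        simp [hj, Matrix.one_apply_ne hij.symm]
      · simp [hi, hj, Matrix.one_apply_ne (Ne.symm hi), Matrix.one_apply_ne (Ne.symm hj)]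
  rw [h, Matrix.det_one_add_mul_comm, Matrix.det_fin_two]
  simp [Matrix.mul_apply, Matrix.one_apply, hij, hij.symm]
  ring

theorem dj_mul {n : ℕ} {R : Type*} [CommRing R] (G : Matrix (Fin (n+2)) (Fin (n+2)) R) :
    G.det * ((G.submatrix Fin.castSucc Fin.castSucc).det * (G.submatrix Fin.succ Fin.succ).det -
      (G.submatrix Fin.castSucc Fin.succ).det * (G.submatrix Fin.succ Fin.castSucc).det)
    = G.det * (G.det * (G.submatrix (fun i : Fin n => i.castSucc.succ)
        (fun i : Fin n => i.castSucc.succ)).det) := by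
  have hne : (0 : Fin (n+2)) ≠ Fin.last (n+1) := by simp [Fin.ext_iff]
  set u : Fin (n+2) → R := fun p => G.adjugate p 0
  set v : Fin (n+2) → R := fun p => G.adjugate p (Fin.last _)
  have h1 := det_two_col 0 (Fin.last (n+1)) hne u v
  have h2 : G * (Matrix.updateCol (Matrix.updateCol (1 : Matrix (Fin (n+2)) (Fin (n+2)) R) 0 u)
      (Fin.last (n+1)) v) = Matrix.updateCol (Matrix.updateCol G 0 (Pi.single 0 G.det))
        (Fin.last (n+1)) (Pi.single (Fin.last (n+1)) G.det) := by
    have hadj := G.mul_adjugate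
    ext p q
    by_cases hj : q = Fin.last (n+1)
    · subst hj
      have := congrFun (congrFun hadj p) (Fin.last (n+1))
      simp only [Matrix.mul_apply, Matrix.smul_apply, Matrix.one_apply] at this
      simp only [Matrix.mul_apply, Matrix.updateCol_self, v]
      rw [this]; simp [Pi.single_apply]
    · by_cases hi : q = 0
      · subst hi
        have := congrFun (congrFun hadj p) 0
        simp only [Matrix.mul_apply, Matrix.smul_apply, Matrix.one_apply] at this
        simp only [Matrix.mul_apply, Matrix.updateCol_ne hne, Matrix.updateCol_self, u]
        rw [this]; simp [Pi.single_apply]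
      · simp [Matrix.mul_apply, Matrix.updateCol_ne hj, Matrix.updateCol_ne hi, Matrix.one_apply]
  have h3 : (Matrix.updateCol (Matrix.updateCol G 0 (Pi.single 0 G.det))
        (Fin.last (n+1)) (Pi.single (Fin.last (n+1)) G.det)).det =
        G.det * (G.det * (G.submatrix (fun i : Fin n => i.castSucc.succ)
        (fun i : Fin n => i.castSucc.succ)).det) := by
    rw [Matrix.det_succ_column_zero, Finset.sum_eq_single 0]
    · rw [Matrix.det_succ_column _ (Fin.last n), Finset.sum_eq_single (Fin.last n)]
      · have e1 : ((Matrix.updateCol (Matrix.updateCol G 0 (Pi.single 0 G.det))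
          (Fin.last (n+1)) (Pi.single (Fin.last (n+1)) G.det)).submatrix
            (Fin.succAbove 0) Fin.succ).submatrix (Fin.last n).succAbove (Fin.last n).succAbove
            = G.submatrix (fun i : Fin n => i.castSucc.succ) (fun i : Fin n => i.castSucc.succ) := by
          ext p q
          have : (q.castSucc.succ : Fin (n+2)) ≠ Fin.last (n+1) := by
            have := q.2
            simp [Fin.ext_iff]; omega
          simp [Matrix.updateCol_ne this, Fin.succAbove_last]
        rw [e1]
        rw [Matrix.updateCol_ne hne, Matrix.updateCol_self]
        simp [← Fin.succ_last, ← two_mul]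
      · intro b _ hb
        simp [← Fin.succ_last, Pi.single_apply, hb]
      · simp
    · intro b _ hb
      simp [Matrix.updateCol_ne hne, hb]
    · simp
  rw [← h3, ← h2, Matrix.det_mul, h1]
  congr 1
  simp only [u, v, Matrix.adjugate_fin_succ_eq_det_submatrix, Fin.succAbove_last]
  simp only [Fin.val_zero, Fin.val_last]
  have hs : ((-1 : R)^(n+1)) * (-1)^(n+1) = 1 := by
    rw [← mul_pow]; simp
  have e0 : (Fin.succAbove (0 : Fin (n+2))) = Fin.succ := by ext; simp
  rw [e0]
  simp only [add_zero, zero_add, pow_zero, one_mul]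
  have hs2 : ((-1 : R)^(n+1+(n+1))) = 1 := by rw [pow_add, hs]
  rw [hs2]
  linear_combination (-(G.submatrix Fin.castSucc Fin.succ).det * (G.submatrix Fin.succ Fin.castSucc).det) * (- hs)

theorem dj {n : ℕ} {R : Type*} [CommRing R] (G : Matrix (Fin (n+2)) (Fin (n+2)) R) :
    G.det * (G.submatrix (fun i : Fin n => i.castSucc.succ)
        (fun i : Fin n => i.castSucc.succ)).det =
    (G.submatrix Fin.castSucc Fin.castSucc).det * (G.submatrix Fin.succ Fin.succ).det -
      (G.submatrix Fin.castSucc Fin.succ).det * (G.submatrix Fin.succ Fin.castSucc).det := by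
  have h := mul_left_cancel₀ (Matrix.det_mvPolynomialX_ne_zero (Fin (n+2)) ℤ)
    (dj_mul (Matrix.mvPolynomialX (Fin (n+2)) (Fin (n+2)) ℤ))
  have h' := congrArg (MvPolynomial.eval₂Hom (Int.castRingHom R) (fun p : Fin (n+2) × Fin (n+2) => G p.1 p.2)) h
  simp only [map_mul, map_sub, RingHom.map_det, RingHom.mapMatrix_apply, ← Matrix.submatrix_map] at h'
  have e : (Matrix.mvPolynomialX (Fin (n+2)) (Fin (n+2)) ℤ).map (MvPolynomial.eval₂Hom (Int.castRingHom R) (fun p : Fin (n+2) × Fin (n+2) => G p.1 p.2)) = G := by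
    ext i j; simp [Matrix.mvPolynomialX]
  rw [e] at h'
  exact h'.symm

theorem det_zero_block {n : ℕ} {R : Type*} [CommRing R] (G : Matrix (Fin n) (Fin n) R) (i : Fin n)
    (h : ∀ p q : Fin n, p ≤ i → i ≤ q → G p q = 0) : G.det = 0 := by
  rw [← Matrix.det_transpose, Matrix.det_apply]
  refine Finset.sum_eq_zero fun σ _ => ?_
  have : ∃ p, p ≤ i ∧ i ≤ σ p := by
    by_contra! hc
    have hle : (Finset.Iic i).card ≤ (Finset.Iio i).card :=
      Finset.card_le_card_of_injOn σ (by intro p hp; simp at hp ⊢; exact hc p hp) σ.injective.injOn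
    simp at hle
  obtain ⟨p, hp, hq⟩ := this
  rw [Finset.prod_eq_zero (Finset.mem_univ p)]
  · simp
  · exact h _ _ hp hq

/-- transfer matrix: one elementary step at a time -/
noncomputable def tmat (K W : ℕ) (f : ℕ → ℤ → ℂ) : ℕ → ℤ → ℤ → ℂ
  | 0 => fun p q => if p = q then 1 else 0
  | (s+1) => fun p q => tmat K W f s p q +
      if q = ((s % W : ℕ) : ℤ) - K + 1 then
        f (s / W + 1) (((s % W : ℕ) : ℤ) - K) * tmat K W f s p (q - 1) else 0

theorem tmat_shift (K W : ℕ) (f : ℕ → ℤ → ℂ) (s : ℕ) (p q : ℤ) :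
    tmat K W (fun m c => f m (c - 1)) s p q = tmat (K+1) W f s (p - 1) (q - 1) := by
  induction s generalizing p q with
  | zero => simp [tmat]
  | succ s ih =>
    simp only [tmat]
    rw [ih, ih]
    have e : (q = ((s % W : ℕ) : ℤ) - K + 1) ↔ (q - 1 = ((s % W : ℕ) : ℤ) - (K + 1 : ℕ) + 1) := by
      push_cast; omega
    have e2 : ((s % W : ℕ) : ℤ) - K - 1 = ((s % W : ℕ) : ℤ) - (K + 1 : ℕ) := by push_cast; ring
    simp only [e, e2]

theorem tmat_lower (K W : ℕ) (f : ℕ → ℤ → ℂ) (s : ℕ) (p q : ℤ) (h : q < p) :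
    tmat K W f s p q = 0 := by
  induction s generalizing p q with
  | zero => simp [tmat, h.ne']
  | succ s ih =>
    simp only [tmat]
    rw [ih _ _ h, ih _ _ (by omega)]
    simp

/-- the determinant with column positions `x j - j` and row positions `mu i - i` -/
noncomputable def tdet (K W : ℕ) (f : ℕ → ℤ → ℂ) (s n : ℕ) (x mu : ℕ → ℤ) : ℂ :=
  (Matrix.of fun i j : Fin n => tmat K W f s (mu i - (i : ℕ)) (x j - (j : ℕ))).det

theorem tdet_zero (K W : ℕ) (f : ℕ → ℤ → ℂ) (s n : ℕ) (x mu : ℕ → ℤ)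
    (hx : ∀ i j, i ≤ j → j < n → x j ≤ x i + (j - i)) (hmu : ∀ i j, i ≤ j → j < n → mu j ≤ mu i)
    (i : ℕ) (hi : i < n) (h : x i < mu i) : tdet K W f s n x mu = 0 := by
  refine det_zero_block _ ⟨i, hi⟩ fun p q hp hq => ?_
  simp only [Matrix.of_apply]
  apply tmat_lower
  have h1 := hx i q hq q.2
  have h2 := hmu p i hp hi
  have hp' : (p : ℕ) ≤ i := hp
  omega

theorem tdet_base (K W : ℕ) (f : ℕ → ℤ → ℂ) (n : ℕ) (x mu : ℕ → ℤ)
    (hx : ∀ i j, i ≤ j → j < n → x j ≤ x i) (hmu : ∀ i j, i ≤ j → j < n → mu j ≤ mu i)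
    (hsub : ∀ i, i < n → mu i ≤ x i) :
    tdet K W f 0 n x mu = if ∀ i, i < n → mu i = x i then 1 else 0 := by
  split_ifs with h
  · unfold tdet
    have : (Matrix.of fun i j : Fin n => tmat K W f 0 (mu i - (i : ℕ)) (x j - (j : ℕ))) = 1 := by
      ext i j
      simp only [Matrix.of_apply, tmat, Matrix.one_apply]
      congr 1
      rw [h i i.2]
      apply propext
      constructor
      · intro e
        rcases le_total (i : ℕ) j with hij | hij
        · have := hx i j hij j.2
          apply Fin.ext; omega
        · have := hx j i hij i.2
          apply Fin.ext; omega
      · rintro rfl; rfl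
    rw [this, Matrix.det_one]
  · push Not at h
    obtain ⟨i, hi, hne⟩ := h
    unfold tdet
    rw [← Matrix.det_transpose]
    refine det_zero_block _ ⟨i, hi⟩ fun p q hp hq => ?_
    simp only [Matrix.transpose_apply, Matrix.of_apply, tmat]
    rw [if_neg]
    have h1 := hx p i hp hi
    have h2 := hmu i q hq q.2
    have h3 := hsub i hi
    have hp' : (p : ℕ) ≤ i := hp
    have hq' : i ≤ (q : ℕ) := hq
    omega

theorem tdet_step_none (K W : ℕ) (f : ℕ → ℤ → ℂ) (s n : ℕ) (x mu : ℕ → ℤ)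
    (h : ∀ i, i < n → x i - i ≠ ((s % W : ℕ) : ℤ) - K + 1) :
    tdet K W f (s+1) n x mu = tdet K W f s n x mu := by
  unfold tdet
  congr 1
  ext i j
  simp only [Matrix.of_apply, tmat]
  rw [if_neg (h j j.2), add_zero]

theorem tdet_step (K W : ℕ) (f : ℕ → ℤ → ℂ) (s n : ℕ) (x mu : ℕ → ℤ)
    (hx : ∀ i j, i ≤ j → j < n → x j ≤ x i)
    (i : ℕ) (hi : i < n) (h : x i - i = ((s % W : ℕ) : ℤ) - K + 1) :
    tdet K W f (s+1) n x mu = tdet K W f s n x mu +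
      f (s / W + 1) (((s % W : ℕ) : ℤ) - K) *
        tdet K W f s n (Function.update x i (x i - 1)) mu := by
  have huniq : ∀ j, j < n → j ≠ i → x j - j ≠ ((s % W : ℕ) : ℤ) - K + 1 := by
    intro j hj hne
    rcases le_total j i with hij | hij
    · have := hx j i hij hi; omega
    · have := hx i j hij hj; omega
  set c := f (s / W + 1) (((s % W : ℕ) : ℤ) - K) with hc
  set X : Matrix (Fin n) (Fin n) ℂ :=
    Matrix.of fun i j : Fin n => tmat K W f s (mu i - (i : ℕ)) (x j - (j : ℕ)) with hX
  set u : Fin n → ℂ := fun p => tmat K W f s (mu p - (p : ℕ)) (x i - i) with hu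
  set v : Fin n → ℂ := fun p => tmat K W f s (mu p - (p : ℕ)) (x i - i - 1) with hv
  have e1 : (Matrix.of fun i j : Fin n => tmat K W f (s+1) (mu i - (i : ℕ)) (x j - (j : ℕ))) =
      X.updateCol ⟨i, hi⟩ (u + c • v) := by
    ext p q
    by_cases hq : q = ⟨i, hi⟩
    · subst hq
      simp [tmat, hu, hv, h, hc]
    · rw [Matrix.updateCol_ne hq]
      simp only [Matrix.of_apply, tmat, hX]
      rw [if_neg (huniq q q.2 (fun e => hq (Fin.ext e))), add_zero]
  have e2 : X.updateCol ⟨i, hi⟩ u = X := by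
    ext p q
    by_cases hq : q = ⟨i, hi⟩
    · subst hq
      simp [hX, hu]
    · rw [Matrix.updateCol_ne hq]
  have e3 : X.updateCol ⟨i, hi⟩ v = Matrix.of fun p j : Fin n => tmat K W f s (mu p - (p : ℕ))
      (Function.update x i (x i - 1) j - (j : ℕ)) := by
    ext p q
    by_cases hq : q = ⟨i, hi⟩
    · subst hq
      simp [hv]
      congr 1; ring
    · rw [Matrix.updateCol_ne hq]
      have : (q : ℕ) ≠ i := fun e => hq (Fin.ext e)
      simp [hX, Function.update_of_ne this]
  unfold tdet
  rw [e1, Matrix.det_updateCol_add, Matrix.det_updateCol_smul, e2, e3]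

theorem tdet_step_rep (K W : ℕ) (f : ℕ → ℤ → ℂ) (s n : ℕ) (x mu : ℕ → ℤ)
    (i : ℕ) (hi : i + 1 < n) (h : x (i+1) = x i) :
    tdet K W f s n (Function.update x i (x i - 1)) mu = 0 := by
  unfold tdet
  refine Matrix.det_zero_of_column_eq (i := ⟨i, by omega⟩) (j := ⟨i+1, hi⟩) (by simp) ?_
  intro p
  simp [h]
  congr 1; ring

/-- semistandardness on a finite set of cells -/
def SSon (S : Finset (ℕ × ℕ)) (T : ℕ × ℕ → ℕ) : Prop :=
  (∀ c ∈ S, ∀ c' ∈ S, c.1 = c'.1 → c.2 ≤ c'.2 → T c ≤ T c') ∧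
  (∀ c ∈ S, ∀ c' ∈ S, c.1 < c'.1 → c.2 = c'.2 → T c < T c')

/-- position of a label in the elementary step order -/
def keyc (K W : ℕ) (c : ℕ × ℕ) (v : ℕ) : ℕ := v * W + (c.2 + K - c.1)

open Classical in
/-- admissible fillings after `s` elementary steps -/
noncomputable def tabs (M K W s : ℕ) (S : Finset (ℕ × ℕ)) : Finset ((ℕ × ℕ) →₀ ℕ) :=
  (S.finsupp fun _ => Finset.Icc 1 M).filter fun T =>
    SSon S T ∧ ∀ c ∈ S, keyc K W c (T c) < s + W

noncomputable def gsum (M K W s : ℕ) (S : Finset (ℕ × ℕ)) (f : ℕ → ℕ × ℕ → ℂ) : ℂ :=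
  ∑ T ∈ tabs M K W s S, ∏ c ∈ S, f (T c) c

theorem mem_tabs {M K W s : ℕ} {S : Finset (ℕ × ℕ)} {T : (ℕ × ℕ) →₀ ℕ} :
    T ∈ tabs M K W s S ↔ (∀ c, c ∉ S → T c = 0) ∧ (∀ c ∈ S, 1 ≤ T c ∧ T c ≤ M) ∧ SSon S T ∧
      ∀ c ∈ S, keyc K W c (T c) < s + W := by
  classical
  unfold tabs
  rw [Finset.mem_filter, Finset.mem_finsupp_iff]
  simp only [Finset.mem_Icc, and_assoc]
  refine and_congr ?_ Iff.rfl
  constructor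
  · intro h c hc
    by_contra h0
    exact hc (h (Finsupp.mem_support_iff.2 h0))
  · intro h c hc
    by_contra h0
    exact (Finsupp.mem_support_iff.1 hc) (h c h0)

theorem tabSum_eq_gsum (M K W B : ℕ) (lam mu : ℕ → ℕ) (f : ℕ → ℕ × ℕ → ℂ)
    (hW : ∀ c ∈ cellsD B lam mu, c.2 + K - c.1 < W) :
    tabSum M B lam mu f = gsum M K W (M * W) (cellsD B lam mu) f := by
  classical
  unfold tabSum gsum
  refine Finset.sum_bij'
    (fun T _ => Finsupp.indicator (cellsD B lam mu) (fun c hc => ((T ⟨c, hc⟩ : Fin M) : ℕ) + 1))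
    (fun T hT => fun c => ⟨T c.1 - 1, by
      have := (mem_tabs.1 hT).2.1 c.1 c.2
      omega⟩) ?_ ?_ ?_ ?_ ?_
  · intro T hT
    simp only [Finset.mem_filter, Finset.mem_univ, true_and] at hT
    rw [mem_tabs]
    refine ⟨fun c hc => Finsupp.indicator_of_notMem hc _, fun c hc => ?_, ⟨?_, ?_⟩, ?_⟩
    · rw [Finsupp.indicator_of_mem hc]
      have := (T ⟨c, hc⟩).2
      omega
    · intro c hc c' hc' h1 h2
      rw [Finsupp.indicator_of_mem hc, Finsupp.indicator_of_mem hc']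
      have := hT.1 ⟨c, hc⟩ ⟨c', hc'⟩ h1 h2
      rw [Fin.le_def] at this
      omega
    · intro c hc c' hc' h1 h2
      rw [Finsupp.indicator_of_mem hc, Finsupp.indicator_of_mem hc']
      have := hT.2 ⟨c, hc⟩ ⟨c', hc'⟩ h1 h2
      rw [Fin.lt_def] at this
      omega
    · intro c hc
      rw [Finsupp.indicator_of_mem hc]
      have := (T ⟨c, hc⟩).2
      have h2 := hW c hc
      have h3 : ((T ⟨c, hc⟩ : ℕ) + 1) * W ≤ M * W := Nat.mul_le_mul_right _ this
      unfold keyc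
      omega
  · intro T hT
    rw [mem_tabs] at hT
    obtain ⟨h0, h1, h2, h3⟩ := hT
    simp only [Finset.mem_filter, Finset.mem_univ, true_and]
    constructor
    · intro c c' e1 e2
      rw [Fin.le_def]
      have := h2.1 c.1 c.2 c'.1 c'.2 e1 e2
      simp only
      omega
    · intro c c' e1 e2
      rw [Fin.lt_def]
      have := h2.2 c.1 c.2 c'.1 c'.2 e1 e2
      have := h1 c.1 c.2
      simp only
      omega
  · intro T hT
    funext c
    apply Fin.ext
    simp
  · intro T hT
    rw [mem_tabs] at hT
    ext c
    by_cases hc : c ∈ cellsD B lam mu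
    · rw [Finsupp.indicator_of_mem hc]
      have := hT.2.1 c hc
      simp only
      omega
    · rw [Finsupp.indicator_of_notMem hc, hT.1 c hc]
  · intro T hT
    rw [← Finset.prod_coe_sort (cellsD B lam mu)]
    refine Finset.prod_congr rfl fun c _ => ?_
    rw [Finsupp.indicator_of_mem c.2]

theorem gsum_zero (M K W : ℕ) (S : Finset (ℕ × ℕ)) (f : ℕ → ℕ × ℕ → ℂ) :
    gsum M K W 0 S f = if S = ∅ then 1 else 0 := by
  unfold gsum
  split_ifs with h
  · subst h
    have : tabs M K W 0 ∅ = {0} := by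
      ext T
      rw [mem_tabs]
      simp [SSon, Finsupp.ext_iff]
    rw [this]; simp
  · obtain ⟨c, hc⟩ := Finset.nonempty_iff_ne_empty.2 h
    have : tabs M K W 0 S = ∅ := by
      rw [Finset.eq_empty_iff_forall_notMem]
      intro T hT
      rw [mem_tabs] at hT
      have h1 := hT.2.1 c hc
      have h2 := hT.2.2.2 c hc
      have : 1 * W ≤ T c * W := Nat.mul_le_mul_right _ h1.1
      unfold keyc at h2
      omega
    rw [this]; simp

theorem gsum_step_none (M K W s : ℕ) (S : Finset (ℕ × ℕ)) (f : ℕ → ℕ × ℕ → ℂ)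
    (h : ∀ T ∈ tabs M K W (s+1) S, ∀ c ∈ S, keyc K W c (T c) ≠ s + W) :
    gsum M K W (s+1) S f = gsum M K W s S f := by
  unfold gsum
  congr 1
  ext T
  constructor
  · intro hT
    have h1 := h T hT
    rw [mem_tabs] at hT ⊢
    refine ⟨hT.1, hT.2.1, hT.2.2.1, fun c hc => ?_⟩
    have := hT.2.2.2 c hc
    have := h1 c hc
    omega
  · intro hT
    rw [mem_tabs] at hT ⊢
    refine ⟨hT.1, hT.2.1, hT.2.2.1, fun c hc => ?_⟩
    have := hT.2.2.2 c hc
    omega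

theorem gsum_step (M K W s : ℕ) (S : Finset (ℕ × ℕ)) (f : ℕ → ℕ × ℕ → ℂ)
    (c0 : ℕ × ℕ) (hc0 : c0 ∈ S) (m : ℕ) (hm1 : 1 ≤ m) (hmM : m ≤ M)
    (hK : ∀ c ∈ S, c.1 ≤ K)
    (hWlt : ∀ c ∈ S, c.2 + K - c.1 < W)
    (hm : keyc K W c0 m = s + W)
    (hright : ∀ c ∈ S, c0.1 = c.1 → c0.2 ≤ c.2 → c = c0)
    (hdown : ∀ c ∈ S, c0.1 < c.1 → c0.2 = c.2 → False)
    (h : ∀ T ∈ tabs M K W (s+1) S, ∀ c ∈ S, c ≠ c0 → keyc K W c (T c) ≠ s + W) :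
    gsum M K W (s+1) S f = gsum M K W s S f + f m c0 * gsum M K W s (S.erase c0) f := by
  classical
  have hWpos : 0 < W := by have := hWlt c0 hc0; omega
  unfold gsum
  rw [← Finset.sum_filter_add_sum_filter_not (tabs M K W (s+1) S) (fun T => T c0 ≠ m)]
  congr 1
  · apply Finset.sum_congr _ (fun _ _ => rfl)
    ext T
    rw [Finset.mem_filter]
    constructor
    · rintro ⟨hT, hne⟩
      have h1 := h T hT
      rw [mem_tabs] at hT ⊢
      refine ⟨hT.1, hT.2.1, hT.2.2.1, fun c hc => ?_⟩
      have h3 := hT.2.2.2 c hc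
      by_cases hcc : c = c0
      · subst hcc
        have : keyc K W c (T c) ≠ s + W := by
          rw [← hm]
          unfold keyc
          intro e
          exact hne (Nat.eq_of_mul_eq_mul_right hWpos (by omega))
        omega
      · have := h1 c hc hcc
        omega
    · intro hT
      rw [mem_tabs] at hT
      refine ⟨?_, ?_⟩
      · rw [mem_tabs]
        refine ⟨hT.1, hT.2.1, hT.2.2.1, fun c hc => ?_⟩
        have := hT.2.2.2 c hc
        omega
      · intro e
        have := hT.2.2.2 c0 hc0
        rw [e] at this
        omega
  · rw [Finset.mul_sum]
    refine Finset.sum_bij' (fun T _ => T.erase c0) (fun T _ => T.update c0 m) ?_ ?_ ?_ ?_ ?_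
    · intro T hT
      rw [Finset.mem_filter] at hT
      obtain ⟨hT, hmm⟩ := hT
      have h1 := h T hT
      rw [mem_tabs] at hT ⊢
      have hes : ∀ c ∈ S.erase c0, (T.erase c0) c = T c := fun c hc =>
        Finsupp.erase_ne (Finset.ne_of_mem_erase hc)
      refine ⟨fun c hc => ?_, fun c hc => ?_, ⟨?_, ?_⟩, fun c hc => ?_⟩
      · by_cases e : c = c0
        · subst e; simp
        · rw [Finsupp.erase_ne e]
          exact hT.1 c (fun hS => hc (Finset.mem_erase.2 ⟨e, hS⟩))
      · rw [hes c hc]; exact hT.2.1 c (Finset.mem_of_mem_erase hc)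
      · intro c hc c' hc'
        rw [hes c hc, hes c' hc']
        exact hT.2.2.1.1 c (Finset.mem_of_mem_erase hc) c' (Finset.mem_of_mem_erase hc')
      · intro c hc c' hc'
        rw [hes c hc, hes c' hc']
        exact hT.2.2.1.2 c (Finset.mem_of_mem_erase hc) c' (Finset.mem_of_mem_erase hc')
      · rw [hes c hc]
        have := hT.2.2.2 c (Finset.mem_of_mem_erase hc)
        have := h1 c (Finset.mem_of_mem_erase hc) (Finset.ne_of_mem_erase hc)
        omega
    · intro T hT
      rw [mem_tabs] at hT
      obtain ⟨h0, h1, h2, h3⟩ := hT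
      have hes : ∀ c, c ≠ c0 → (T.update c0 m) c = T c := fun c hc => by
        simp [Finsupp.update_apply, hc]
      have hself : (T.update c0 m) c0 = m := by simp
      rw [Finset.mem_filter, mem_tabs]
      refine ⟨⟨fun c hc => ?_, fun c hc => ?_, ⟨?_, ?_⟩, fun c hc => ?_⟩, by simp⟩
      · have e : c ≠ c0 := fun e => hc (e ▸ hc0)
        rw [hes c e]
        exact h0 c (fun hS => hc (Finset.mem_of_mem_erase hS))
      · by_cases e : c = c0
        · subst e; rw [hself]; exact ⟨hm1, hmM⟩
        · rw [hes c e]; exact h1 c (Finset.mem_erase.2 ⟨e, hc⟩)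
      · intro c hc c' hc' e1 e2
        by_cases e : c = c0
        · subst e
          rw [hright c' hc' e1 e2]
        · by_cases e' : c' = c0
          · subst e'
            rw [hes c e, hself]
            have hk := h3 c (Finset.mem_erase.2 ⟨e, hc⟩)
            have hw := hWlt _ hc0
            unfold keyc at hk hm
            by_contra hlt
            have : (m + 1) * W ≤ T c * W := Nat.mul_le_mul_right _ (by omega)
            rw [add_mul] at this
            omega
          · rw [hes c e, hes c' e']
            exact h2.1 c (Finset.mem_erase.2 ⟨e, hc⟩) c' (Finset.mem_erase.2 ⟨e', hc'⟩) e1 e2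
      · intro c hc c' hc' e1 e2
        by_cases e : c = c0
        · subst e
          exact (hdown c' hc' e1 e2).elim
        · by_cases e' : c' = c0
          · subst e'
            rw [hes c e, hself]
            have hk := h3 c (Finset.mem_erase.2 ⟨e, hc⟩)
            have hw := hK _ hc0
            unfold keyc at hk hm
            by_contra hlt
            have : m * W ≤ T c * W := Nat.mul_le_mul_right _ (by omega)
            omega
          · rw [hes c e, hes c' e']
            exact h2.2 c (Finset.mem_erase.2 ⟨e, hc⟩) c' (Finset.mem_erase.2 ⟨e', hc'⟩) e1 e2
      · by_cases e : c = c0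
        · subst e; rw [hself]; omega
        · rw [hes c e]
          have := h3 c (Finset.mem_erase.2 ⟨e, hc⟩)
          omega
    · intro T hT
      rw [Finset.mem_filter] at hT
      have hmm : T c0 = m := by simpa using hT.2
      ext c
      by_cases e : c = c0
      · subst e; simp [hmm]
      · simp [Finsupp.update_apply, e, Finsupp.erase_ne e]
    · intro T hT
      rw [mem_tabs] at hT
      have := hT.1 c0 (by simp)
      ext c
      by_cases e : c = c0
      · subst e; simp [this]
      · simp [Finsupp.update_apply, e, Finsupp.erase_ne e]
    · intro T hT
      rw [Finset.mem_filter] at hT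
      have hmm : T c0 = m := by simpa using hT.2
      rw [← Finset.mul_prod_erase S _ hc0, hmm]
      congr 1
      refine Finset.prod_congr rfl fun c hc => ?_
      rw [Finsupp.erase_ne (Finset.ne_of_mem_erase hc)]

theorem mem_cells {n : ℕ} {lam mu : ℕ → ℕ} (hlam : ∀ i j, i ≤ j → j < n → lam j ≤ lam i)
    (c : ℕ × ℕ) : c ∈ cellsD n lam mu ↔ c.1 < n ∧ mu c.1 ≤ c.2 ∧ c.2 < lam c.1 := by
  unfold cellsD
  simp only [Finset.mem_filter, Finset.mem_product, Finset.mem_range]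
  constructor
  · rintro ⟨⟨h1, h2⟩, h3, h4⟩
    exact ⟨h1, h3, h4⟩
  · rintro ⟨h1, h3, h4⟩
    have := hlam 0 c.1 (Nat.zero_le _) h1
    exact ⟨⟨h1, by omega⟩, h3, h4⟩

theorem key_corner {M K W n s : ℕ} {lam mu : ℕ → ℕ}
    (hlam : ∀ i j, i ≤ j → j < n → lam j ≤ lam i)
    (hmu : ∀ i j, i ≤ j → j < n → mu j ≤ mu i) (hnK : n ≤ K)
    (hW : ∀ i, i < n → lam i + K < W)
    (T : (ℕ × ℕ) →₀ ℕ) (hT : T ∈ tabs M K W (s+1) (cellsD n lam mu))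
    (c : ℕ × ℕ) (hc : c ∈ cellsD n lam mu) (hk : keyc K W c (T c) = s + W) :
    lam c.1 = c.2 + 1 ∧ (c.1 + 1 < n → lam (c.1 + 1) < lam c.1) ∧ c.2 + K - c.1 = s % W := by
  rw [mem_tabs] at hT
  obtain ⟨h0, h1, h2, h3⟩ := hT
  have hc' := (mem_cells hlam c).1 hc
  have hw := hW c.1 hc'.1
  have hright : lam c.1 = c.2 + 1 := by
    by_contra hne
    have hm : (c.1, c.2 + 1) ∈ cellsD n lam mu := by
      rw [mem_cells hlam]; simp only; omega
    have a1 := h2.1 c hc _ hm rfl (by simp)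
    have a2 := h3 _ hm
    have a3 := Nat.mul_le_mul_right W a1
    unfold keyc at a2 hk
    simp only at a2
    omega
  refine ⟨hright, ?_, ?_⟩
  · intro hlt
    by_contra hge
    have b1 := hlam c.1 (c.1+1) (by omega) hlt
    have b2 := hmu c.1 (c.1+1) (by omega) hlt
    have hm : (c.1 + 1, c.2) ∈ cellsD n lam mu := by
      rw [mem_cells hlam]; simp only; omega
    have a1 := h2.2 c hc _ hm (by simp) rfl
    have a2 := h3 _ hm
    have a3 := Nat.mul_le_mul_right W (Nat.succ_le_of_lt a1)
    rw [Nat.succ_mul] at a3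
    unfold keyc at a2 hk
    simp only at a2
    omega
  · unfold keyc at hk
    have hlt : c.2 + K - c.1 < W := by omega
    have := congrArg (· % W) hk
    simpa [Nat.mod_eq_of_lt hlt] using this

theorem jt (M K W n : ℕ) (f : ℕ → ℤ → ℂ) (mu : ℕ → ℕ)
    (hmu : ∀ i j, i ≤ j → j < n → mu j ≤ mu i) (hnK : n ≤ K) (s : ℕ) (hs : s ≤ M * W)
    (lam : ℕ → ℕ) (hlam : ∀ i j, i ≤ j → j < n → lam j ≤ lam i)
    (hsub : ∀ i, i < n → mu i ≤ lam i)
    (hW : ∀ i, i < n → lam i + K < W) :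
    gsum M K W s (cellsD n lam mu) (fun m c => f m ((c.2 : ℤ) - (c.1 : ℤ))) =
      tdet K W f s n (fun i => (lam i : ℤ)) (fun i => (mu i : ℤ)) := by
  induction s generalizing lam with
  | zero =>
    rw [gsum_zero, tdet_base]
    · have : (cellsD n lam mu = ∅) ↔ ∀ i, i < n → (mu i : ℤ) = lam i := by
        constructor
        · intro he i hi
          by_contra hne
          have h1 := hsub i hi
          have : (i, mu i) ∈ cellsD n lam mu := by
            rw [mem_cells hlam]; simp only; omega
          rw [he] at this
          simp at this
        · intro h
          rw [Finset.eq_empty_iff_forall_notMem]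
          intro c hc
          rw [mem_cells hlam] at hc
          have := h c.1 hc.1
          omega
      simp only [this]
    · intro i j h1 h2; exact_mod_cast hlam i j h1 h2
    · intro i j h1 h2; exact_mod_cast hmu i j h1 h2
    · intro i hi; exact_mod_cast hsub i hi
  | succ s ih =>
    have hs' : s < M * W := hs
    have ih0 := ih hs'.le
    have hlamZ : ∀ i j, i ≤ j → j < n → (lam j : ℤ) ≤ lam i := by
      intro i j h1 h2; exact_mod_cast hlam i j h1 h2
    have hmuZ : ∀ i j, i ≤ j → j < n → (mu j : ℤ) ≤ mu i := by
      intro i j h1 h2; exact_mod_cast hmu i j h1 h2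
    by_cases hex : ∃ i, i < n ∧ (lam i : ℤ) - i = ((s % W : ℕ) : ℤ) - K + 1
    · obtain ⟨i, hi, hpos⟩ := hex
      have huniq : ∀ j, j < n → (lam j : ℤ) - j = ((s % W : ℕ) : ℤ) - K + 1 → j = i := by
        intro j hj hj2
        rcases le_total j i with hij | hij
        · have := hlam j i hij hi; omega
        · have := hlam i j hij hj; omega
      have hwi := hW i hi
      have hcell : ∀ T ∈ tabs M K W (s+1) (cellsD n lam mu), ∀ c ∈ cellsD n lam mu,
          keyc K W c (T c) = s + W → c = (i, lam i - 1) ∧ mu i < lam i ∧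
            (i + 1 < n → lam (i+1) < lam i) := by
        intro T hT c hc hk
        obtain ⟨a1, a2, a3⟩ := key_corner hlam hmu hnK hW T hT c hc hk
        rw [mem_cells hlam] at hc
        have hi' : c.1 = i := huniq c.1 hc.1 (by omega)
        rw [← hi']
        refine ⟨?_, by omega, a2⟩
        ext
        · rfl
        · simp only; omega
      rw [tdet_step K W f s n _ _ hlamZ i hi hpos]
      by_cases hcor : mu i < lam i ∧ (i + 1 < n → lam (i+1) < lam i)
      · obtain ⟨hc1, hc2⟩ := hcor
        have hbelow : ∀ j, i < j → j < n → lam j < lam i := by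
          intro j h1 h2
          have := hlam (i+1) j h1 h2
          have := hc2 (by omega)
          omega
        have hmem : (i, lam i - 1) ∈ cellsD n lam mu := by
          rw [mem_cells hlam]; simp only; omega
        have hWpos : 0 < W := by omega
        have hmm : s / W < M := (Nat.div_lt_iff_lt_mul hWpos).2 hs'
        rw [gsum_step M K W s _ _ (i, lam i - 1) hmem (s / W + 1) (Nat.le_add_left _ _) hmm]
        · have hlam' : ∀ p q, p ≤ q → q < n → Function.update lam i (lam i - 1) q ≤
              Function.update lam i (lam i - 1) p := by
            intro p q h1 h2
            have h3 := hlam p q h1 h2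
            by_cases hp : p = i
            · by_cases hq : q = i
              · rw [hp, hq]
              · rw [hp, Function.update_self, Function.update_of_ne hq]
                have := hbelow q (by omega) h2
                omega
            · by_cases hq : q = i
              · rw [hq, Function.update_self, Function.update_of_ne hp]
                rw [hq] at h3; omega
              · rw [Function.update_of_ne hp, Function.update_of_ne hq]; exact h3
          have e1 : (cellsD n lam mu).erase (i, lam i - 1) =
              cellsD n (Function.update lam i (lam i - 1)) mu := by
            ext c
            rw [Finset.mem_erase, mem_cells hlam, mem_cells hlam']
            by_cases hci : c.1 = i
            · rw [hci, Function.update_self]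
              have : c ≠ (i, lam i - 1) ↔ c.2 ≠ lam i - 1 := by
                rw [Ne, Prod.ext_iff]; simp [hci]
              rw [this]; omega
            · rw [Function.update_of_ne hci]
              have : c ≠ (i, lam i - 1) := fun e => hci (by rw [e])
              simp [this]
          rw [e1, ih0 lam hlam hsub hW, ih0 _ hlam']
          · congr 1
            congr 1
            · congr 1
              simp only
              omega
            · congr 1
              funext j
              by_cases hj : j = i
              · subst hj
                simp only [Function.update_self]; omega
              · simp [Function.update_of_ne hj]
          · intro j hj
            by_cases hji : j = i
            · subst hji; rw [Function.update_self]; omega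
            · rw [Function.update_of_ne hji]; exact hsub j hj
          · intro j hj
            by_cases hji : j = i
            · subst hji; rw [Function.update_self]; omega
            · rw [Function.update_of_ne hji]; exact hW j hj
        · intro c hc
          rw [mem_cells hlam] at hc; omega
        · intro c hc
          rw [mem_cells hlam] at hc
          have := hW c.1 hc.1; omega
        · unfold keyc
          simp only
          have h1 : lam i - 1 + K - i = s % W := by omega
          have h2 := Nat.div_add_mod s W
          rw [h1, add_mul, mul_comm (s / W)]
          omega
        · intro c hc h1 h2
          rw [mem_cells hlam] at hc
          simp only at h1 h2
          rw [← h1] at hc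
          ext
          · exact h1.symm
          · simp only; omega
        · intro c hc h1 h2
          rw [mem_cells hlam] at hc
          simp only at h1 h2
          have := hbelow c.1 h1 hc.1
          omega
        · intro T hT c hc hne hk
          exact hne (hcell T hT c hc hk).1
      · rw [gsum_step_none, ih0 lam hlam hsub hW]
        · have hz : tdet K W f s n (Function.update (fun i => (lam i : ℤ)) i ((lam i : ℤ) - 1))
              (fun i => (mu i : ℤ)) = 0 := by
            by_cases hm : mu i < lam i
            · have h1 : i + 1 < n ∧ lam i ≤ lam (i+1) := by
                by_contra hcon
                apply hcor
                refine ⟨hm, fun h => ?_⟩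
                by_contra h2
                exact hcon ⟨h, by omega⟩
              have h2 := hlam i (i+1) (by omega) h1.1
              exact tdet_step_rep K W f s n (fun i => (lam i : ℤ)) _ i h1.1
                (by omega)
            · refine tdet_zero K W f s n _ _ ?_ hmuZ i hi ?_
              · intro p q h1 h2
                have h3 := hlam p q h1 h2
                by_cases hp : p = i
                · by_cases hq : q = i
                  · rw [hp, hq]; omega
                  · rw [hp, Function.update_self, Function.update_of_ne hq]
                    rw [hp] at h3
                    omega
                · by_cases hq : q = i
                  · rw [hq, Function.update_self, Function.update_of_ne hp]
                    rw [hq] at h3; omega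
                  · rw [Function.update_of_ne hp, Function.update_of_ne hq]; omega
              · rw [Function.update_self]; omega
          rw [hz]; ring
        · intro T hT c hc hk
          exact hcor (hcell T hT c hc hk).2
    · have hex' : ∀ i, i < n → (lam i : ℤ) - i ≠ ((s % W : ℕ) : ℤ) - K + 1 :=
        fun i hi h => hex ⟨i, hi, h⟩
      rw [tdet_step_none _ _ _ _ _ _ _ hex', gsum_step_none, ih0 lam hlam hsub hW]
      intro T hT c hc hk
      obtain ⟨a1, a2, a3⟩ := key_corner hlam hmu hnK hW T hT c hc hk
      rw [mem_cells hlam] at hc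
      exact hex' c.1 hc.1 (by omega)

theorem zetaZ_eq (M B K W n : ℕ) (hnB : n ≤ B) (hnK : n ≤ K) (x : ℕ → ℤ) (mu : ℕ → ℕ)
    (hx : ∀ i j, i ≤ j → j < n → x j ≤ x i)
    (hmu : ∀ i j, i ≤ j → j < n → mu j ≤ mu i)
    (hW : ∀ i, i < n → x i + K < W) (a : ℤ → ℂ) :
    zetaZ M B (fun i => if i < n then x i else 0) (fun i => if i < n then (mu i : ℤ) else 0) a =
      tdet K W (fun m c => ((m : ℕ) : ℂ) ^ (-(a c))) (M * W) n x (fun i => (mu i : ℤ)) := by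
  by_cases hle : ∀ i, i < n → (mu i : ℤ) ≤ x i
  · have hskew : IsSkewZ B (fun i => if i < n then x i else 0)
        (fun i => if i < n then (mu i : ℤ) else 0) := by
      refine ⟨⟨fun i => ?_, fun i => ?_, fun i hi => ?_⟩,
        ⟨fun i => ?_, fun i => ?_, fun i hi => ?_⟩, fun i => ?_⟩
      · simp only
        split_ifs with h1 h2 h2
        · exact hx _ _ (by omega) h1
        · omega
        · have := hle i h2; omega
        · rfl
      · simp only
        split_ifs with h1
        · have := hle i h1; omega
        · rfl
      · simp only; rw [if_neg (by omega)]
      · simp only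
        split_ifs with h1 h2 h2
        · exact_mod_cast hmu _ _ (by omega) h1
        · omega
        · omega
        · rfl
      · simp only
        split_ifs with h1 <;> omega
      · simp only; rw [if_neg (by omega)]
      · simp only
        split_ifs with h1
        · exact hle i h1
        · rfl
    unfold zetaZ
    rw [if_pos hskew]
    unfold zetaT zetaTF
    set L : ℕ → ℕ := fun i => (if i < n then x i else 0).toNat with hL
    set U : ℕ → ℕ := fun i => (if i < n then (mu i : ℤ) else 0).toNat with hU
    have hLn : ∀ i, i < n → (L i : ℤ) = x i := by
      intro i hi
      have := hle i hi
      simp only [hL, if_pos hi]; omega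
    have hUn : ∀ i, i < n → (U i : ℤ) = mu i := by
      intro i hi
      simp only [hU, if_pos hi]; omega
    have hL0 : ∀ i, n ≤ i → L i = 0 := by
      intro i hi
      simp [hL, not_lt.2 hi]
    have hLanti : ∀ i j, i ≤ j → j < n → L j ≤ L i := by
      intro i j h1 h2
      have := hx i j h1 h2
      have := hLn i (by omega)
      have := hLn j h2
      omega
    have hUanti : ∀ i j, i ≤ j → j < n → U j ≤ U i := by
      intro i j h1 h2
      have := hmu i j h1 h2
      have := hUn i (by omega)
      have := hUn j h2
      omega
    have hLanti' : ∀ i j, i ≤ j → j < B → L j ≤ L i := by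
      intro i j h1 h2
      by_cases h : j < n
      · exact hLanti i j h1 h
      · rw [hL0 j (by omega)]; omega
    have ecell : cellsD B L U = cellsD n L U := by
      ext c
      rw [mem_cells hLanti', mem_cells hLanti]
      constructor
      · rintro ⟨h1, h2, h3⟩
        refine ⟨?_, h2, h3⟩
        by_contra h
        rw [hL0 c.1 (by omega)] at h3
        omega
      · rintro ⟨h1, h2, h3⟩
        exact ⟨by omega, h2, h3⟩
    have hWL : ∀ i, i < n → L i + K < W := by
      intro i hi
      have := hW i hi
      have := hLn i hi
      omega
    rw [tabSum_eq_gsum M K W, ecell]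
    · have := jt M K W n (fun m c => ((m : ℕ) : ℂ) ^ (-(a c))) U hUanti hnK (M * W) le_rfl L hLanti
        (by intro i hi; have := hle i hi; have := hLn i hi; have := hUn i hi; omega) hWL
      rw [this]
      unfold tdet
      congr 1
      ext i j
      simp only [Matrix.of_apply]
      rw [hLn j j.2, hUn i i.2]
    · rw [ecell]
      intro c hc
      rw [mem_cells hLanti] at hc
      have := hWL c.1 hc.1
      omega
  · have hns : ¬ IsSkewZ B (fun i => if i < n then x i else 0)
        (fun i => if i < n then (mu i : ℤ) else 0) := by
      intro h
      apply hle
      intro i hi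
      have := h.2.2 i
      simpa [hi] using this
    unfold zetaZ
    rw [if_neg hns]
    push Not at hle
    obtain ⟨i, hi, hlt⟩ := hle
    symm
    refine tdet_zero _ _ _ _ _ _ _ ?_ ?_ i hi hlt
    · intro p q h1 h2
      have := hx p q h1 h2
      omega
    · intro p q h1 h2
      exact_mod_cast hmu p q h1 h2

/-- Desnanot–Jacobi relation for truncated Schur multiple zeta values, row version. -/
theorem desnanot_jacobi_zeta_row (M : ℕ) (hM : 0 < M) (a : ℤ → ℂ)
    (k : ℕ) (hk : 1 ≤ k)
    (lam mu : ℕ → ℕ)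
    (hlam : ∀ i, lam (i + 1) ≤ lam i) (hmu : ∀ i, mu (i + 1) ≤ mu i)
    (hsub : ∀ i, mu i ≤ lam i)
    (hlen : ∀ i, k + 1 ≤ i → lam i = 0) :
    zetaZ M (k + 1) (fun i => if i < k + 1 then (lam i : ℤ) else 0)
        (fun i => if i < k + 1 then (mu i : ℤ) else 0) a *
      zetaZ M (k + 1) (fun i => if i < k - 1 then (lam (i + 1) : ℤ) else 0)
        (fun i => if i < k - 1 then (mu (i + 1) : ℤ) else 0) (fun c => a (c - 1)) =
    zetaZ M (k + 1) (fun i => if i < k then (lam i : ℤ) else 0)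
        (fun i => if i < k then (mu i : ℤ) else 0) a *
      zetaZ M (k + 1) (fun i => if i < k then (lam (i + 1) : ℤ) else 0)
        (fun i => if i < k then (mu (i + 1) : ℤ) else 0) (fun c => a (c - 1)) -
    zetaZ M (k + 1) (fun i => if i < k then (lam (i + 1) : ℤ) - 1 else 0)
        (fun i => if i < k then (mu i : ℤ) else 0) a *
      zetaZ M (k + 1) (fun i => if i < k then (lam i : ℤ) + 1 else 0)
        (fun i => if i < k then (mu (i + 1) : ℤ) else 0) (fun c => a (c - 1)) := by
  obtain ⟨n, rfl⟩ : ∃ n, k = n + 1 := ⟨k - 1, by omega⟩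
  have hl : ∀ i j, i ≤ j → lam j ≤ lam i := fun i j h => antitone_nat_of_succ_le hlam h
  have hm : ∀ i j, i ≤ j → mu j ≤ mu i := fun i j h => antitone_nat_of_succ_le hmu h
  set K := n + 2 with hK
  set W := lam 0 + K + 3 with hW
  set f : ℕ → ℤ → ℂ := fun m c => ((m : ℕ) : ℂ) ^ (-(a c)) with hf
  have hl0 : ∀ i, lam i ≤ lam 0 := fun i => hl 0 i (Nat.zero_le _)
  rw [zetaZ_eq M (n + 1 + 1) (K + 1) W (n + 1 + 1) (by omega) (by omega) (fun i => (lam i : ℤ)) mu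
    (fun i j h1 _ => by exact_mod_cast hl i j h1) (fun i j h1 _ => hm i j h1)
    (fun i _ => by have := hl0 i; push_cast; omega) a]
  rw [zetaZ_eq M (n + 1 + 1) K W (n + 1 - 1) (by omega) (by omega) (fun i => (lam (i + 1) : ℤ))
    (fun i => mu (i + 1))
    (fun i j h1 _ => by exact_mod_cast hl (i+1) (j+1) (by omega))
    (fun i j h1 _ => hm (i+1) (j+1) (by omega))
    (fun i _ => by have := hl0 (i+1); push_cast; omega) (fun c => a (c - 1))]
  rw [zetaZ_eq M (n + 1 + 1) (K + 1) W (n + 1) (by omega) (by omega) (fun i => (lam i : ℤ)) mu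
    (fun i j h1 _ => by exact_mod_cast hl i j h1) (fun i j h1 _ => hm i j h1)
    (fun i _ => by have := hl0 i; push_cast; omega) a]
  rw [zetaZ_eq M (n + 1 + 1) K W (n + 1) (by omega) (by omega) (fun i => (lam (i + 1) : ℤ))
    (fun i => mu (i + 1))
    (fun i j h1 _ => by exact_mod_cast hl (i+1) (j+1) (by omega))
    (fun i j h1 _ => hm (i+1) (j+1) (by omega))
    (fun i _ => by have := hl0 (i+1); push_cast; omega) (fun c => a (c - 1))]
  rw [zetaZ_eq M (n + 1 + 1) (K + 1) W (n + 1) (by omega) (by omega)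
    (fun i => (lam (i + 1) : ℤ) - 1) mu
    (fun i j h1 _ => by have := hl (i+1) (j+1) (by omega); omega)
    (fun i j h1 _ => hm i j h1)
    (fun i _ => by have := hl0 (i+1); push_cast; omega) a]
  rw [zetaZ_eq M (n + 1 + 1) K W (n + 1) (by omega) (by omega)
    (fun i => (lam i : ℤ) + 1) (fun i => mu (i + 1))
    (fun i j h1 _ => by have := hl i j h1; omega)
    (fun i j h1 _ => hm (i+1) (j+1) (by omega))
    (fun i _ => by have := hl0 i; push_cast; omega) (fun c => a (c - 1))]
  have key := dj (Matrix.of fun i j : Fin (n + 2) =>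
    tmat (K + 1) W f (M * W) ((mu i : ℤ) - (i : ℕ)) ((lam j : ℤ) - (j : ℕ)))
  have hshift : ∀ p q, tmat K W (fun m c => ((m : ℕ) : ℂ) ^ (-(a (c - 1)))) (M * W) p q =
      tmat (K + 1) W f (M * W) (p - 1) (q - 1) := fun p q => tmat_shift K W f (M * W) p q
  unfold tdet
  simp only [hshift]
  have aux : ∀ (y : ℤ) (i : ℕ), y - ((i + 1 : ℕ) : ℤ) = y - i - 1 := by
    intro y i; push_cast; ring
  have aux2 : ∀ (y : ℤ) (i : ℕ), y - 1 - (i : ℤ) = y - i - 1 := by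
    intro y i; ring
  have aux3 : ∀ (y : ℤ) (i : ℕ), y + 1 - (i : ℤ) - 1 = y - i := by
    intro y i; ring
  simp only [Matrix.submatrix, Matrix.of_apply, Fin.val_succ, Fin.val_castSucc, aux] at key
  simp only [aux2, aux3]
  exact key
end
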